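/- arXiv:2209.10757 — 2 statements merged into one kernel-verified Lean document; each statement's English description precedes it below -/
import Mathlib

section
/- Let (A_r)_{r∈ℚ} be a graded extension of V in K[ℚ,σ] of Type (h), let W_r = O_l(A_r) and W = ∪_{r∈ℚ} W_r, and assume there exists t ∈ ℚ with O_l(A_t) = W. Then there exists a positive integer l such that H_{1/l} is a graded extension of V in K[X^{1/l}, X^{-1/l}; σ(1/l)] of Type (h) with O_l(A_{1/l}) = W. -/
open scoped Pointwise

variable {K : Type*} [DivisionRing K]

/-- `V` is a total valuation ring of the division ring `K`. -/
def IsTVR (V : Subring K) : Prop := ∀ k : K, k ≠ 0 → k ∈ V ∨ k⁻¹ ∈ V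

/-- The additive group generated by the elementwise products of two subsets, as a set. -/
def aprod (S T : Set K) : Set K := (AddSubgroup.closure (S * T) : Set K)

/-- `O_l(S) = {a ∈ K : aS ⊆ S}`. -/
def Ol (S : Set K) : Set K := {a : K | ∀ x ∈ S, a * x ∈ S}

/-- `O_r(S) = {a ∈ K : Sa ⊆ S}`. -/
def Orr (S : Set K) : Set K := {a : K | ∀ x ∈ S, x * a ∈ S}

/-- `(J : I)_r = {a ∈ K : Ia ⊆ J}`. -/
def residR (J I : Set K) : Set K := {a : K | ∀ x ∈ I, x * a ∈ J}

/-- The Jacobson radical of a total valuation ring `W`, as a set: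
`{x ∈ W : x = 0 ∨ x⁻¹ ∉ W}`. -/
def jacS (W : Set K) : Set K := {x : K | x ∈ W ∧ (x = 0 ∨ x⁻¹ ∉ W)}

/-- `S⁻ = {c⁻¹ : 0 ≠ c ∈ S}`. -/
def invS (S : Set K) : Set K := {x : K | ∃ c ∈ S, c ≠ 0 ∧ x = c⁻¹}

/-- `S` is an additive subgroup of `K`. -/
def IsAddSubgrp (S : Set K) : Prop := (0 : K) ∈ S ∧ ∀ x ∈ S, ∀ y ∈ S, x - y ∈ S

/-- `*I = ⋂ {Wc : c ∈ K, I ⊆ Wc}` where `W = O_l(I)`. -/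
def lstar (I : Set K) : Set K := ⋂ c ∈ {c : K | I ⊆ Ol I * {c}}, Ol I * {c}

/-- A family `(A_r)` of additive subgroups of `K` is a graded extension of `V0`
with support the additive subgroup `H ⊆ ℚ`. -/
def IsGradedExtOn (H : Set ℚ) (V0 : Set K) (σ : ℚ → (K ≃+* K)) (A : ℚ → Set K) : Prop :=
  (∀ r ∈ H, IsAddSubgrp (A r)) ∧ A 0 = V0 ∧
  (∀ r ∈ H, A r ∪ (σ r '' invS (A (-r))) = Set.univ) ∧
  (∀ r ∈ H, ∀ s ∈ H, aprod (A r) (σ r '' A s) ⊆ A (r + s))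

/-- `ℤr = {ir : i ∈ ℤ}` as a subset of `ℚ`. -/
def zmulSet (r : ℚ) : Set ℚ := {s : ℚ | ∃ i : ℤ, s = (i : ℚ) * r}

/-- Graded extension of `V0` in `K[ℚ,σ]`. -/
def IsGradedExtQ (V0 : Set K) (σ : ℚ → (K ≃+* K)) (A : ℚ → Set K) : Prop :=
  IsGradedExtOn Set.univ V0 σ A

/-- `H_r` is a graded extension of `V0` in `K[X^r, X^{-r}; σ(r)]`. -/
def IsGradedExtHr (V0 : Set K) (σ : ℚ → (K ≃+* K)) (A : ℚ → Set K) (r : ℚ) : Prop :=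
  IsGradedExtOn (zmulSet r) V0 σ A

/-- `H_r` is of Type (I). -/
def HrTypeI (σ : ℚ → (K ≃+* K)) (A : ℚ → Set K) (r : ℚ) : Prop :=
  ∀ i j : ℤ, 0 < i → 0 < j →
    aprod (A ((i : ℚ) * r)) (σ ((i : ℚ) * r) '' A ((j : ℚ) * r)) = A (((i + j : ℤ) : ℚ) * r) ∧
    aprod (A (-((i : ℚ) * r))) (σ (-((i : ℚ) * r)) '' A (-((j : ℚ) * r)))
      = A (-(((i + j : ℤ) : ℚ) * r))

/-- The whole family `(A_r)_{r ∈ ℚ}` is of Type (I). -/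
def FamTypeI (σ : ℚ → (K ≃+* K)) (A : ℚ → Set K) : Prop :=
  ∀ g h : ℚ, 0 < g → 0 < h →
    aprod (A g) (σ g '' A h) = A (g + h) ∧
    aprod (A (-g)) (σ (-g) '' A (-h)) = A (-g - h)

/-- `M_0 = V`, `M_{ir} = A_r A_r^{σ(r)} ⋯ A_r^{σ((i-1)r)}`. -/
def Mir (V0 : Set K) (σ : ℚ → (K ≃+* K)) (A : ℚ → Set K) (r : ℚ) : ℕ → Set K
  | 0 => V0
  | 1 => A r
  | n + 2 => aprod (Mir V0 σ A r (n + 1)) (σ (((n + 1 : ℕ) : ℚ) * r) '' A r)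

/-- `H_r` is of Type (a). -/
def HrTypeA (V0 : Set K) (σ : ℚ → (K ≃+* K)) (A : ℚ → Set K) (r : ℚ) : Prop :=
  ∃ a : K, A r = V0 * {a} ∧ A r = {a} * (σ r '' V0) ∧ A (-r) = V0 * {σ (-r) a⁻¹}

/-- `H_r` is of Type (b). -/
def HrTypeB (σ : ℚ → (K ≃+* K)) (A : ℚ → Set K) (r : ℚ) : Prop :=
  ∃ a : K, A r = Ol (A r) * {a} ∧ {a} * (σ r '' Ol (A r)) ⊂ A r

/-- `H_r` is of Type (c). -/
def HrTypeC (σ : ℚ → (K ≃+* K)) (A : ℚ → Set K) (r : ℚ) : Prop :=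
  ∃ a : K, A r = Ol (A r) * {a} ∧ A r ⊂ {a} * (σ r '' Ol (A r))

/-- `H_r` is of Type (d). -/
def HrTypeD (σ : ℚ → (K ≃+* K)) (A : ℚ → Set K) (r : ℚ) : Prop :=
  ∃ a : K, A r = Ol (A r) * {a} ∧ A r = {a} * (σ r '' Ol (A r)) ∧
    A (-r) = jacS (Ol (A r)) * {σ (-r) a⁻¹} ∧
    aprod (jacS (Ol (A r))) (jacS (Ol (A r))) = jacS (Ol (A r))

/-- `H_r` is of Type (e). -/
def HrTypeE (σ : ℚ → (K ≃+* K)) (A : ℚ → Set K) (r : ℚ) : Prop :=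
  ∃ a b : K, A r = Ol (A r) * {a} ∧ A r = {a} * (σ r '' Ol (A r)) ∧
    A (-r) = jacS (Ol (A r)) * {σ (-r) a⁻¹} ∧
    jacS (Ol (A r)) = Ol (A r) * {b⁻¹}

/-- `H_r` is of Type (f). -/
def HrTypeF (A : ℚ → Set K) (r : ℚ) : Prop := A r ⊂ lstar (A r)

/-- `H_r` is of Type (g). -/
def HrTypeG (V0 : Set K) (σ : ℚ → (K ≃+* K)) (A : ℚ → Set K) (r : ℚ) : Prop :=
  lstar (A r) = A r ∧
    ∀ i : ℕ, 0 < i → ¬ ∃ c : K, lstar (Mir V0 σ A r i) = Ol (A r) * {c}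

/-- `H_r` is of Type (h). -/
def HrTypeH (V0 : Set K) (σ : ℚ → (K ≃+* K)) (A : ℚ → Set K) (r : ℚ) : Prop :=
  lstar (A r) = A r ∧
    ∃ i : ℕ, 0 < i ∧ ∃ c : K, lstar (Mir V0 σ A r i) = Ol (A r) * {c}

/-- A graded map `f : ℚ → ℤ`. -/
def IsGradedMap (f : ℚ → ℤ) : Prop :=
  f 0 = 0 ∧ (∀ s t : ℚ, f s + f t ≤ f (s + t)) ∧ (∀ s : ℚ, -1 ≤ f s + f (-s))

namespace S17

structure P2 {G : Type*} [Group G] (d : G → ℚ) (C : Set G) : Prop where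
  hd : ∀ x y, d (x * y) = d x + d y
  mul : ∀ x ∈ C, ∀ y ∈ C, x * y ∈ C
  tot : ∀ x, x ∈ C ∨ x⁻¹ ∈ C
  surj : ∀ r, ∃ x, d x = r
  hOl : ∀ r a, d a = 0 → (∀ y ∈ C, d y = r → a * y ∈ C) → a ∈ C
  hJ : ∀ j, d j = 0 → j⁻¹ ∉ C → ∃ j1 j2, d j1 = 0 ∧ d j2 = 0 ∧ j1⁻¹ ∉ C ∧ j2⁻¹ ∉ C ∧ j = j1 * j2

def Rp {G : Type*} [Group G] (d : G → ℚ) (C : Set G) (x : G) : Prop :=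
  ∀ y, d y = d x → (y ∈ C → y * x⁻¹ ∈ C) ∧ (x * y⁻¹ ∉ C → y ∈ C)

theorem d_one {G : Type*} [Group G] {d : G → ℚ} (hd : ∀ x y, d (x * y) = d x + d y) :
    d 1 = 0 := by
  have := hd 1 1
  rw [mul_one] at this; linarith

theorem d_inv {G : Type*} [Group G] {d : G → ℚ} (hd : ∀ x y, d (x * y) = d x + d y) (x : G) :
    d x⁻¹ = - d x := by
  have := hd x x⁻¹
  rw [mul_inv_cancel, d_one hd] at this; linarith

theorem Or_Ol {G : Type*} [Group G] {d : G → ℚ} {C : Set G}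
    (hd : ∀ x y, d (x * y) = d x + d y)
    (mul : ∀ x ∈ C, ∀ y ∈ C, x * y ∈ C)
    (tot : ∀ x, x ∈ C ∨ x⁻¹ ∈ C) (r : ℚ) (a : G) (ha : d a = 0)
    (h : ∀ y ∈ C, d y = r → y * a ∈ C) : ∀ x ∈ C, d x = -r → a * x ∈ C := by
  intro x hx hdx
  by_contra hn
  have h1 := (tot (a * x)).resolve_left hn
  have h2 := h _ h1 (by rw [d_inv hd, hd, ha, hdx]; ring)
  have e : (a * x)⁻¹ * a = x⁻¹ := by group
  rw [e] at h2
  have h3 := h _ h2 (by rw [d_inv hd, hdx]; ring)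
  have h4 := mul _ hx _ h3
  have e : x * (x⁻¹ * a) = a := by group
  rw [e] at h4
  exact hn (mul _ h4 _ hx)

variable {G : Type*} [Group G] {d : G → ℚ} {C : Set G}

namespace P2

theorem hOr (H : P2 d C) (r : ℚ) (a : G) (ha : d a = 0)
    (h : ∀ y ∈ C, d y = r → y * a ∈ C) : a ∈ C :=
  H.hOl (-r) a ha (Or_Ol H.hd H.mul H.tot r a ha h)

theorem one_mem (H : P2 d C) : (1 : G) ∈ C := by
  have := H.tot 1
  simpa using this

theorem conj (H : P2 d C) {x : G} (hx : Rp d C x) {a : G} (ha : d a = 0) :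
    x * a * x⁻¹ ∈ C ↔ a ∈ C := by
  constructor
  · intro h
    apply H.hOr (d x) a ha
    intro y hy hdy
    have h1 := (hx y hdy).1 hy
    by_cases hxC : x ∈ C
    · have := H.mul _ (H.mul _ h1 _ h) _ hxC
      have e : y * x⁻¹ * (x * a * x⁻¹) * x = y * a := by group
      rwa [e] at this
    · refine (hx (y * a) (by rw [H.hd, ha, hdy]; ring)).2 ?_
      intro h2
      have h3 := H.mul _ h _ h2
      have e : x * a * x⁻¹ * (x * (y * a)⁻¹) = x * y⁻¹ := by group
      rw [e] at h3
      have := H.mul _ h3 _ hy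
      rw [inv_mul_cancel_right] at this
      exact hxC this
  · intro h
    by_contra hc
    have h1 := (hx (x * a⁻¹) (by rw [H.hd, d_inv H.hd, ha]; ring)).2 (by
      have e : x * (x * a⁻¹)⁻¹ = x * a * x⁻¹ := by group
      rwa [e])
    have h2 := H.mul _ h1 _ h
    rw [inv_mul_cancel_right] at h2
    exact hc ((hx (x * a) (by rw [H.hd, ha]; ring)).1 (H.mul _ h2 _ h))

theorem conj' (H : P2 d C) {x : G} (hx : Rp d C x) {a : G} (ha : d a = 0) :
    x⁻¹ * a * x ∈ C ↔ a ∈ C := by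
  rw [← H.conj hx (a := x⁻¹ * a * x) (by rw [H.hd, H.hd, d_inv H.hd, ha]; ring)]
  have e : x * (x⁻¹ * a * x) * x⁻¹ = a := by group
  rw [e]

theorem rp_one (H : P2 d C) : Rp d C 1 := by
  intro y _
  constructor
  · intro h; simpa using h
  · intro h
    exact (H.tot y).resolve_right (by simpa using h)

/-- J x ⊆ C. -/
theorem jx (H : P2 d C) {x : G} (hx : Rp d C x) {j : G} (hj : d j = 0) (hj' : j⁻¹ ∉ C) :
    j * x ∈ C := by
  refine (hx (j * x) (by rw [H.hd, hj]; ring)).2 ?_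
  have e : x * (j * x)⁻¹ = j⁻¹ := by group
  rwa [e]

theorem rp_inv (H : P2 d C) {x : G} (hx : Rp d C x) : Rp d C x⁻¹ := by
  intro y hy
  rw [d_inv H.hd] at hy
  constructor
  · intro hyC
    by_contra hn
    have h0 : (y⁻¹ * x⁻¹)⁻¹ ∉ C := by
      intro h
      have := (H.conj' hx (a := (y⁻¹ * x⁻¹)⁻¹) (by
        rw [d_inv H.hd, H.hd, d_inv H.hd, d_inv H.hd, hy]; ring)).2 h
      have e : x⁻¹ * (y⁻¹ * x⁻¹)⁻¹ * x = y * x⁻¹⁻¹ := by group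
      rw [e] at this
      exact hn this
    obtain ⟨j1, j2, d1, d2, n1, n2, e⟩ := H.hJ (y⁻¹ * x⁻¹) (by
        rw [H.hd, d_inv H.hd, d_inv H.hd, hy]; ring) h0
    have h1 := H.mul _ (H.jx hx d2 n2) _ hyC
    have e2 : j2 * x * y = j1⁻¹ := by
      have : x * y = (j1 * j2)⁻¹ := by rw [← e]; group
      rw [mul_assoc, this]; group
    rw [e2] at h1
    exact n1 h1
  · intro h
    by_contra hn
    have h1 := (H.tot y).resolve_left hn
    have h2 := (hx y⁻¹ (by rw [d_inv H.hd, hy]; ring)).1 h1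
    have := (H.conj' hx (a := y⁻¹ * x⁻¹) (by
        rw [H.hd, d_inv H.hd, d_inv H.hd, hy]; ring)).2 h2
    have e : x⁻¹ * (y⁻¹ * x⁻¹) * x = x⁻¹ * y⁻¹ := by group
    rw [e] at this
    exact h this

theorem rp_mul (H : P2 d C) {x y : G} (hx : Rp d C x) (hy : Rp d C y) : Rp d C (x * y) := by
  intro z hz
  rw [H.hd] at hz
  have hdj : d (z * (x * y)⁻¹) = 0 := by rw [H.hd, d_inv H.hd, H.hd, hz]; ring
  constructor
  · intro hzC
    by_contra hn
    obtain ⟨j1, j2, d1, d2, n1, n2, e⟩ := H.hJ (z * (x * y)⁻¹)⁻¹ (by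
        rw [d_inv H.hd, hdj]; ring) (by simpa using hn)
    have hc : (x⁻¹ * j2 * x)⁻¹ ∉ C := by
      intro h
      have e3 : (x⁻¹ * j2 * x)⁻¹ = x⁻¹ * j2⁻¹ * x := by group
      rw [e3, H.conj' hx (by rw [d_inv H.hd, d2]; ring)] at h
      exact n2 h
    have h1 := H.mul _ (H.jx (H.rp_inv hx) (by rw [H.hd, H.hd, d_inv H.hd, d2]; ring) hc) _ hzC
    have e2 : x⁻¹ * j2 * x * x⁻¹ * z = x⁻¹ * j1⁻¹ * x * y := by
      have : z = (j1 * j2)⁻¹ * (x * y) := by rw [← e]; group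
      rw [this]; group
    rw [e2] at h1
    have h2 := (hy _ (by rw [H.hd, H.hd, H.hd, d_inv H.hd, d_inv H.hd, d1]; ring)).1 h1
    rw [mul_inv_cancel_right, H.conj' hx (by rw [d_inv H.hd, d1]; ring)] at h2
    exact n1 h2
  · intro h
    obtain ⟨j1, j2, d1, d2, n1, n2, e⟩ := H.hJ (z * (x * y)⁻¹) hdj (by
      have e : (z * (x * y)⁻¹)⁻¹ = x * y * z⁻¹ := by group
      rwa [e])
    have hc : (x⁻¹ * j2 * x)⁻¹ ∉ C := by
      intro h
      have e3 : (x⁻¹ * j2 * x)⁻¹ = x⁻¹ * j2⁻¹ * x := by group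
      rw [e3, H.conj' hx (by rw [d_inv H.hd, d2]; ring)] at h
      exact n2 h
    have h1 := H.mul _ (H.jx hx d1 n1) _
      (H.jx hy (by rw [H.hd, H.hd, d_inv H.hd, d2]; ring) hc)
    have e2 : j1 * x * (x⁻¹ * j2 * x * y) = z := by
      have : z = (j1 * j2) * (x * y) := by rw [← e]; group
      rw [this]; group
    rwa [e2] at h1

/-- uniqueness of the kind. -/
theorem uniq (H : P2 d C) {x x' : G} (hx : Rp d C x) (hx' : Rp d C x') (hdx : d x = d x')
    (h : x ∈ C) : x' ∈ C := by
  by_contra hn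
  have hj : (x * x'⁻¹)⁻¹ ∉ C := by
    intro h1
    have := H.mul _ h1 _ h
    have e : (x * x'⁻¹)⁻¹ * x = x' := by group
    rw [e] at this
    exact hn this
  obtain ⟨j1, j2, d1, d2, n1, n2, e⟩ := H.hJ (x * x'⁻¹) (by
    rw [H.hd, d_inv H.hd, hdx]; ring) hj
  have h1 := (hx _ (by rw [H.hd, d2, hdx]; ring)).1 (H.jx hx' d2 n2)
  have e2 : j2 * x' * x⁻¹ = j1⁻¹ := by
    have : x' * x⁻¹ = (j1 * j2)⁻¹ := by rw [← e]; group
    rw [mul_assoc, this]; group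
  rw [e2] at h1
  exact n1 h1

theorem dich0 (H : P2 d C) {a b : ℚ} {z : G} (hdz : d z = a + b)
    (hn : ∀ p ∈ C, ∀ q ∈ C, d p = a → d q = b → p * q ≠ z) :
    ∀ y ∈ C, d y = a + b → y * z⁻¹ ∈ C := by
  intro y hy hdy
  apply H.hOr (-a) _ (by rw [H.hd, d_inv H.hd, hdy, hdz]; ring)
  intro p hp hdp
  have h1 := H.mul _ hp _ hy
  rw [← mul_assoc]
  by_contra h2
  have h3 := (H.tot _).resolve_left h2
  refine hn _ h3 _ h1 ?_ ?_ ?_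
  · rw [d_inv H.hd, H.hd, H.hd, d_inv H.hd, hdp, hdy, hdz]; ring
  · rw [H.hd, hdp, hdy]; ring
  · group

/-- dichotomy -/
theorem dich (H : P2 d C) (a b : ℚ) :
    (∀ z ∈ C, d z = a + b → ∃ p ∈ C, ∃ q ∈ C, d p = a ∧ d q = b ∧ p * q = z) ∨
    ∃ z ∈ C, d z = a + b ∧ Rp d C z ∧
      ∀ y, d y = a + b → (z * y⁻¹ ∉ C ↔ ∃ p ∈ C, ∃ q ∈ C, d p = a ∧ d q = b ∧ p * q = y) := by
  by_cases h : ∀ z ∈ C, d z = a + b → ∃ p ∈ C, ∃ q ∈ C, d p = a ∧ d q = b ∧ p * q = z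
  · exact Or.inl h
  right
  push Not at h
  obtain ⟨z, hz, hdz, hn⟩ := h
  have key := H.dich0 hdz (fun p hp q hq h1 h2 => hn p hp q hq h1 h2)
  have key2 : ∀ y, z * y⁻¹ ∉ C → y ∈ C := by
    intro y h
    have := (H.tot _).resolve_left h
    have := H.mul _ this _ hz
    have e : (z * y⁻¹)⁻¹ * z = y := by group
    rwa [e] at this
  refine ⟨z, hz, hdz, ?_, ?_⟩
  · intro y hy
    exact ⟨fun h => key y h (hy.trans hdz), key2 y⟩
  · intro y hdy
    constructor
    · intro h
      by_contra hc
      push Not at hc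
      exact h (H.dich0 hdy (fun p hp q hq h1 h2 => hc p hp q hq h1 h2) z hz hdz)
    · rintro ⟨p, hp, q, hq, hdp, hdq, rfl⟩ h
      refine hn _ (H.mul _ h _ hp) q hq ?_ hdq (by group)
      rw [H.hd, H.hd, d_inv H.hd, hdz, hdy, hdp]; ring

def R (d : G → ℚ) (C : Set G) : Set ℚ := {r | ∃ x, d x = r ∧ Rp d C x}

def S (d : G → ℚ) (C : Set G) : Set ℚ := {r | ∃ x ∈ C, d x = r ∧ Rp d C x}

theorem R_add (H : P2 d C) {r s : ℚ} (hr : r ∈ R d C) (hs : s ∈ R d C) : r + s ∈ R d C := by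
  obtain ⟨x, rfl, hx⟩ := hr
  obtain ⟨y, rfl, hy⟩ := hs
  exact ⟨x * y, H.hd _ _, H.rp_mul hx hy⟩

theorem R_neg (H : P2 d C) {r : ℚ} (hr : r ∈ R d C) : -r ∈ R d C := by
  obtain ⟨x, rfl, hx⟩ := hr
  exact ⟨x⁻¹, d_inv H.hd _, H.rp_inv hx⟩

theorem R_nat (H : P2 d C) {r : ℚ} (hr : r ∈ R d C) (n : ℕ) : (n : ℚ) * r ∈ R d C := by
  induction n with
  | zero => exact ⟨1, by simp [d_one H.hd], H.rp_one⟩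
  | succ n ih =>
    have := H.R_add ih hr
    convert this using 1
    push_cast; ring

theorem R_int (H : P2 d C) {r : ℚ} (hr : r ∈ R d C) (n : ℤ) : (n : ℚ) * r ∈ R d C := by
  obtain ⟨m, rfl | rfl⟩ := n.eq_nat_or_neg
  · exact_mod_cast H.R_nat hr m
  · have := H.R_neg (H.R_nat hr m)
    convert this using 1
    push_cast; ring

theorem S_add (H : P2 d C) {r s : ℚ} (hr : r ∈ S d C) (hs : s ∈ S d C) : r + s ∈ S d C := by
  obtain ⟨x, hxC, rfl, hx⟩ := hr
  obtain ⟨y, hyC, rfl, hy⟩ := hs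
  exact ⟨x * y, H.mul _ hxC _ hyC, H.hd _ _, H.rp_mul hx hy⟩

theorem S_nat (H : P2 d C) {r : ℚ} (hr : r ∈ S d C) (n : ℕ) : (n : ℚ) * r ∈ S d C := by
  induction n with
  | zero => exact ⟨1, H.one_mem, by simp [d_one H.hd], H.rp_one⟩
  | succ n ih =>
    have := H.S_add ih hr
    convert this using 1
    push_cast; ring

theorem S_tot (H : P2 d C) {r : ℚ} (hr : r ∈ R d C) : r ∈ S d C ∨ -r ∈ S d C := by
  obtain ⟨x, rfl, hx⟩ := hr
  rcases H.tot x with h | h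
  · exact Or.inl ⟨x, h, rfl, hx⟩
  · exact Or.inr ⟨x⁻¹, h, d_inv H.hd _, H.rp_inv hx⟩

theorem ratmul {p q : ℚ} (h : p * q < 0) : ∃ n m : ℕ, (n + 1 : ℚ) * p + m * q = 0 := by
  have hq : q ≠ 0 := by rintro rfl; simp at h
  have hpq : 0 < -p / q := by
    have : -p / q = -(p * q) / (q * q) := by field_simp
    rw [this]
    have : 0 < q * q := mul_self_pos.2 hq
    apply div_pos <;> linarith
  set x := -p / q with hx
  refine ⟨x.den - 1, x.num.natAbs, ?_⟩
  have h1 : ((x.den - 1 : ℕ) : ℚ) + 1 = x.den := by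
    have := x.den_pos
    have : x.den - 1 + 1 = x.den := by omega
    exact_mod_cast this
  have h2 : ((x.num.natAbs : ℕ) : ℚ) = x.num := by
    have : 0 < x.num := Rat.num_pos.2 hpq
    have : (x.num.natAbs : ℤ) = x.num := by omega
    have h3 := congrArg (Int.cast : ℤ → ℚ) this
    rwa [Int.cast_natCast] at h3
  rw [h1, h2]
  have h3 : (x.num : ℚ) = x * x.den := (Rat.mul_den_eq_num x).symm
  rw [h3]
  have : x * q = -p := by rw [hx]; field_simp
  linear_combination (x.den : ℚ) * this

theorem S_cone (H : P2 d C) {p q : ℚ} (hp : p ∈ S d C) (hq : q ∈ S d C) (h : p * q < 0) :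
    -p ∈ S d C := by
  obtain ⟨n, m, e⟩ := ratmul h
  have := H.S_add (H.S_nat hp n) (H.S_nat hq m)
  convert this using 1
  linear_combination -e

theorem S_all (H : P2 d C) (hR : ∀ r, r ∈ R d C) {p q : ℚ} (hp : p ∈ S d C) (hq : q ∈ S d C)
    (h : p * q < 0) (r : ℚ) : r ∈ S d C := by
  rcases H.S_tot (hR r) with h1 | h1
  · exact h1
  rcases eq_or_ne r 0 with rfl | h0
  · simpa using h1
  rw [← neg_neg r]
  by_cases h2 : -r * p < 0
  · exact H.S_cone h1 hp h2
  · apply H.S_cone h1 hq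
    by_contra h3
    push Not at h2 h3
    have h4 := mul_nonneg h2 h3
    have h5 : -r * p * (-r * q) = (r * r) * (p * q) := by ring
    have h6 : 0 < r * r := mul_self_pos.2 h0
    nlinarith

end P2
end S17
namespace S17

structure P1 {G : Type*} [Group G] (d : G → ℚ) (B W : Set G) (t : ℚ) : Prop where
  hd : ∀ x y, d (x * y) = d x + d y
  mul : ∀ x ∈ B, ∀ y ∈ B, x * y ∈ B
  tot : ∀ x, x ∈ B ∨ x⁻¹ ∈ B
  surj : ∀ r, ∃ x, d x = r
  hW : ∀ a, a ∈ W ↔ d a = 0 ∧ ∀ y ∈ B, d y = t → a * y ∈ B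
  hmax : ∀ r a, d a = 0 → (∀ y ∈ B, d y = r → a * y ∈ B) → a ∈ W
  hJ : ∀ j ∈ W, j⁻¹ ∉ W →
    ∃ j1 ∈ W, ∃ j2 ∈ W, j1⁻¹ ∉ W ∧ j2⁻¹ ∉ W ∧ j = j1 * j2

def CC {G : Type*} [Group G] (B W : Set G) : Set G := {x | ∃ w ∈ W, ∃ b ∈ B, x = w * b}

variable {G : Type*} [Group G] {d : G → ℚ} {B W : Set G} {t : ℚ}

namespace P1

theorem one_mem (H : P1 d B W t) : (1 : G) ∈ B := by
  have := H.tot 1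
  simpa using this

theorem dW (H : P1 d B W t) {a : G} (h : a ∈ W) : d a = 0 := ((H.hW a).1 h).1

theorem VW (H : P1 d B W t) {a : G} (h : a ∈ B) (h0 : d a = 0) : a ∈ W :=
  (H.hW a).2 ⟨h0, fun y hy _ => H.mul _ h _ hy⟩

theorem Wmul (H : P1 d B W t) {a b : G} (ha : a ∈ W) (hb : b ∈ W) : a * b ∈ W := by
  refine (H.hW _).2 ⟨by rw [H.hd, H.dW ha, H.dW hb]; ring, fun y hy hdy => ?_⟩
  rw [mul_assoc]
  exact ((H.hW a).1 ha).2 _ (((H.hW b).1 hb).2 _ hy hdy) (by rw [H.hd, H.dW hb, hdy]; ring)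

theorem Wone (H : P1 d B W t) : (1 : G) ∈ W := H.VW H.one_mem (d_one H.hd)

theorem Wtot (H : P1 d B W t) {a : G} (h : d a = 0) : a ∈ W ∨ a⁻¹ ∈ W := by
  rcases H.tot a with h1 | h1
  · exact Or.inl (H.VW h1 h)
  · exact Or.inr (H.VW h1 (by rw [d_inv H.hd, h]; ring))

theorem BC (H : P1 d B W t) {x : G} (h : x ∈ B) : x ∈ CC B W :=
  ⟨1, H.Wone, x, h, by simp⟩

/-- Lemma N -/
theorem nonT (H : P1 d B W t) {w b : G} (hw : w ∈ W) (hb : b ∈ B) (hn : w * b ∉ B) :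
    (w * b)⁻¹ ∈ B ∧ w⁻¹ ∈ B ∧ (∀ a, d a = 0 → ((w * b) * a * (w * b)⁻¹ ∈ W ↔ a ∈ W)) ∧
    (∀ y ∈ CC B W, d y = d (w * b) → y * (w * b)⁻¹ ∈ W) := by
  have dw := H.dW hw
  have hwW := ((H.hW w).1 hw).2
  have hxi := (H.tot _).resolve_left hn
  have hwi : w⁻¹ ∈ B := by
    have := H.mul _ hb _ hxi
    have e : b * (w * b)⁻¹ = w⁻¹ := by group
    rwa [e] at this
  have hwi' : w⁻¹ ∈ W := H.VW hwi (by rw [d_inv H.hd, dw]; ring)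
  have A1 : ∀ y ∈ B, d y = t - d b → (w * b) * y ∈ B := by
    intro y hy hdy
    rw [mul_assoc]
    exact hwW _ (H.mul _ hb _ hy) (by rw [H.hd, hdy]; ring)
  have c1 : ∀ a, d a = 0 → ((w * b) * a * (w * b)⁻¹ ∈ W) → a ∈ W := by
    intro a da ha
    refine H.hmax (t - d b) a da fun y hy hdy => ?_
    have h1 := ((H.hW _).1 ha).2 _ (A1 y hy hdy) (by rw [H.hd, H.hd, dw, hdy]; ring)
    have h2 := H.mul _ hxi _ h1
    have e : (w * b)⁻¹ * (w * b * a * (w * b)⁻¹ * (w * b * y)) = a * y := by group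
    rwa [e] at h2
  have A2 : ∀ z ∈ B, d z = t → (w * b) * z ∈ B := by
    intro z hz hdz
    have h1 : (w * b)⁻¹ * w * (w * b) ∈ W := by
      apply c1 _ (by rw [H.hd, H.hd, d_inv H.hd, dw]; ring)
      have e : w * b * ((w * b)⁻¹ * w * (w * b)) * (w * b)⁻¹ = w := by group
      rwa [e]
    have h2 := H.mul _ hb _ (((H.hW _).1 h1).2 z hz hdz)
    have e : b * ((w * b)⁻¹ * w * (w * b) * z) = w * b * z := by group
    rwa [e] at h2
  refine ⟨hxi, hwi, fun a da => ⟨c1 a da, fun ha => ?_⟩, ?_⟩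
  · refine H.hmax (d b + t) _ (by rw [H.hd, H.hd, d_inv H.hd, da]; ring) fun y hy hdy => ?_
    have h1 := H.mul _ hxi _ hy
    have hd1 : d ((w * b)⁻¹ * y) = t := by rw [H.hd, d_inv H.hd, H.hd, dw, hdy]; ring
    have h2 := ((H.hW _).1 ha).2 _ h1 hd1
    have h3 := A2 _ h2 (by rw [H.hd, hd1, da]; ring)
    have e : w * b * (a * ((w * b)⁻¹ * y)) = w * b * a * (w * b)⁻¹ * y := by group
    rwa [e] at h3
  · rintro y ⟨w', hw', b', hb', rfl⟩ hdy
    rw [mul_assoc]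
    apply H.Wmul hw'
    apply H.VW (H.mul _ hb' _ hxi)
    rw [H.hd, H.dW hw', zero_add] at hdy
    rw [H.hd, d_inv H.hd, hdy]; ring

theorem Cleft (H : P1 d B W t) {w x : G} (hw : w ∈ W) (hx : x ∈ CC B W) : w * x ∈ CC B W := by
  obtain ⟨w', hw', b, hb, rfl⟩ := hx
  exact ⟨w * w', H.Wmul hw hw', b, hb, by group⟩

theorem Bright (H : P1 d B W t) {w b : G} (hw : w ∈ W) (hb : b ∈ B) : b * w ∈ CC B W := by
  by_cases h : ∀ y ∈ B, d y = - d b → w * y ∈ B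
  · by_cases h2 : b * w ∈ B
    · exact H.BC h2
    exfalso
    have h3 := (H.tot _).resolve_left h2
    have dw := H.dW hw
    have h4 := h _ h3 (by rw [d_inv H.hd, H.hd, dw]; ring)
    have e : w * (b * w)⁻¹ = b⁻¹ := by group
    rw [e] at h4
    have h5 := h _ h4 (by rw [d_inv H.hd])
    have h6 := H.mul _ h5 _ hb
    rw [inv_mul_cancel_right] at h6
    exact h2 (H.mul _ hb _ h6)
  · push Not at h
    obtain ⟨y, hy, hdy, hn⟩ := h
    obtain ⟨h1, h2, h3, h4⟩ := H.nonT hw hy hn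
    have dw := H.dW hw
    have h5 : (w * y)⁻¹ * (w * w) * (w * y) ∈ W := by
      rw [← h3 _ (by rw [H.hd, H.hd, H.hd, d_inv H.hd, dw]; ring)]
      have e : w * y * ((w * y)⁻¹ * (w * w) * (w * y)) * (w * y)⁻¹ = w * w := by group
      rw [e]; exact H.Wmul hw hw
    have h6 : b * y ∈ W := H.VW (H.mul _ hb _ hy) (by rw [H.hd, hdy]; ring)
    refine ⟨b * y * ((w * y)⁻¹ * (w * w) * (w * y)), H.Wmul h6 h5, (w * y)⁻¹, h1, ?_⟩
    group

theorem Cmul (H : P1 d B W t) : ∀ x ∈ CC B W, ∀ y ∈ CC B W, x * y ∈ CC B W := by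
  rintro _ ⟨w, hw, b, hb, rfl⟩ _ ⟨w', hw', b', hb', rfl⟩
  obtain ⟨w2, hw2, b2, hb2, e⟩ := H.Bright hw' hb
  refine ⟨w * w2, H.Wmul hw hw2, b2 * b', H.mul _ hb2 _ hb', ?_⟩
  calc w * b * (w' * b') = w * (b * w') * b' := by group
    _ = _ := by rw [e]; group

theorem C0 (H : P1 d B W t) {x : G} (h0 : d x = 0) : x ∈ CC B W ↔ x ∈ W := by
  constructor
  · rintro ⟨w, hw, b, hb, rfl⟩
    rw [H.hd, H.dW hw, zero_add] at h0
    exact H.Wmul hw (H.VW hb h0)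
  · intro h
    exact ⟨x, h, 1, H.one_mem, by simp⟩

theorem WC (H : P1 d B W t) {x : G} (h : x ∈ W) : x ∈ CC B W := (H.C0 (H.dW h)).2 h

theorem CBW (H : P1 d B W t) {x : G} (hx : x ∈ CC B W) : ∃ b ∈ B, ∃ w ∈ W, x = b * w := by
  obtain ⟨w, hw, b, hb, rfl⟩ := hx
  by_cases h : w * b ∈ B
  · exact ⟨w * b, h, 1, H.Wone, by simp⟩
  obtain ⟨h1, h2, h3, h4⟩ := H.nonT hw hb h
  have dw := H.dW hw
  refine ⟨b, hb, (w * b)⁻¹ * w * (w * b), ?_, by group⟩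
  rw [← h3 _ (by rw [H.hd, H.hd, d_inv H.hd, dw]; ring)]
  have e : w * b * ((w * b)⁻¹ * w * (w * b)) * (w * b)⁻¹ = w := by group
  rwa [e]

def T (d : G → ℚ) (B W : Set G) : Set ℚ := {r | ∀ w ∈ W, ∀ b ∈ B, d b = r → w * b ∈ B}

theorem T_C (H : P1 d B W t) {r : ℚ} (hr : r ∈ T d B W) {x : G} (hdx : d x = r) :
    x ∈ CC B W ↔ x ∈ B := by
  constructor
  · rintro ⟨w, hw, b, hb, rfl⟩
    exact hr w hw b hb (by rw [← hdx, H.hd, H.dW hw]; ring)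
  · exact H.BC

theorem p2 (H : P1 d B W t) : P2 d (CC B W) where
  hd := H.hd
  mul := H.Cmul
  tot x := (H.tot x).imp H.BC H.BC
  surj := H.surj
  hOl r a ha h := by
    rw [H.C0 ha]
    by_cases hT : r ∈ T d B W
    · refine H.hmax r a ha fun y hy hdy => ?_
      rw [← H.T_C hT (by rw [H.hd, ha, hdy]; ring)]
      exact h y (H.BC hy) hdy
    · simp only [T, Set.mem_ofPred_eq] at hT
      push Not at hT
      obtain ⟨w, hw, b, hb, hdb, hn⟩ := hT
      obtain ⟨h1, h2, h3, h4⟩ := H.nonT hw hb hn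
      have hdx : d (w * b) = r := by rw [H.hd, H.dW hw, hdb]; ring
      have := h4 _ (h (w * b) ⟨w, hw, b, hb, rfl⟩ hdx) (by rw [H.hd, ha]; ring)
      rwa [mul_inv_cancel_right] at this
  hJ j hj hn := by
    rw [H.C0 (by rw [d_inv H.hd, hj]; ring)] at hn
    obtain ⟨j1, h1, j2, h2, n1, n2, e⟩ := H.hJ j ((H.Wtot hj).resolve_right hn) hn
    have d1 := H.dW h1
    have d2 := H.dW h2
    exact ⟨j1, j2, d1, d2, by rwa [H.C0 (by rw [d_inv H.hd, d1]; ring)],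
      by rwa [H.C0 (by rw [d_inv H.hd, d2]; ring)], e⟩

open P2 in
theorem nonT_rp (H : P1 d B W t) {r : ℚ} (hT : r ∉ T d B W) :
    r ∈ S d (CC B W) ∧ -r ∈ S d (CC B W) := by
  simp only [T, Set.mem_ofPred_eq] at hT
  push Not at hT
  obtain ⟨w, hw, b, hb, hdb, hn⟩ := hT
  obtain ⟨h1, h2, h3, h4⟩ := H.nonT hw hb hn
  have hdx : d (w * b) = r := by rw [H.hd, H.dW hw, hdb]; ring
  have hxC : w * b ∈ CC B W := ⟨w, hw, b, hb, rfl⟩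
  have hrp : Rp d (CC B W) (w * b) := by
    intro y hy
    refine ⟨fun h => H.WC (h4 y h hy), fun h => ?_⟩
    have := (H.p2.tot _).resolve_left h
    have := H.Cmul _ this _ hxC
    have e : (w * b * y⁻¹)⁻¹ * (w * b) = y := by group
    rwa [e] at this
  exact ⟨⟨_, hxC, hdx, hrp⟩, ⟨(w * b)⁻¹, H.BC h1, by rw [d_inv H.hd, hdx], H.p2.rp_inv hrp⟩⟩

open P2 in
theorem SR {d : G → ℚ} {C : Set G} {r : ℚ} (h : r ∈ S d C) : r ∈ R d C := by
  obtain ⟨x, _, h1, h2⟩ := h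
  exact ⟨x, h1, h2⟩

open P2 in
theorem nR_T (H : P1 d B W t) {r : ℚ} (h : r ∉ R d (CC B W)) : r ∈ T d B W := by
  by_contra hT
  exact h (SR (H.nonT_rp hT).1)

open P2 in
theorem u_mem (H : P1 d B W t) {a b : ℚ} {z : G} (hz : z ∈ B) (hdz : d z = a + b)
    (hn : ∀ p ∈ B, ∀ q ∈ B, d p = a → d q = b → p * q ≠ z) : a + b ∈ R d (CC B W) := by
  by_contra hu
  have hC : ∃ p ∈ CC B W, ∃ q ∈ CC B W, d p = a ∧ d q = b ∧ p * q = z := by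
    rcases H.p2.dich a b with h | ⟨z', _, h1, h2, _⟩
    · exact h z (H.BC hz) hdz
    · exact absurd ⟨z', h1, h2⟩ hu
  obtain ⟨p, hp, q, hq, hdp, hdq, e⟩ := hC
  have hab : a ∈ T d B W ∨ b ∈ T d B W := by
    by_contra hc
    push Not at hc
    exact hu (H.p2.R_add (SR (H.nonT_rp hc.1).1) (SR (H.nonT_rp hc.2).1))
  rcases hab with hT | hT
  · obtain ⟨w, hw, q', hq', rfl⟩ := hq
    have dw := H.dW hw
    have h1 : p * w ∈ B := by
      rw [← H.T_C hT (by rw [H.hd, dw, hdp]; ring)]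
      exact H.Cmul _ hp _ (H.WC hw)
    exact hn _ h1 _ hq' (by rw [H.hd, dw, hdp]; ring) (by rw [← hdq, H.hd, dw]; ring)
      (by rw [← e]; group)
  · obtain ⟨p', hp', w, hw, rfl⟩ := H.CBW hp
    have dw := H.dW hw
    have h1 : w * q ∈ B := by
      rw [← H.T_C hT (by rw [H.hd, dw, hdq]; ring)]
      exact H.Cleft hw hq
    exact hn _ hp' _ h1 (by rw [← hdp, H.hd, dw]; ring) (by rw [H.hd, dw, hdq]; ring)
      (by rw [← e]; group)

open P2 in
theorem prod_S (H : P1 d B W t) {a b : ℚ} {z : G} (hz : z ∈ CC B W) (hdz : d z = a + b)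
    (ha : a ∈ S d (CC B W)) (hb : b ∈ S d (CC B W)) :
    ∃ p ∈ CC B W, ∃ q ∈ CC B W, d p = a ∧ d q = b ∧ p * q = z := by
  obtain ⟨x, hx, rfl, rx⟩ := ha
  obtain ⟨y, hy, rfl, ry⟩ := hb
  have h1 := (H.p2.rp_mul rx ry z (by rw [hdz, H.hd])).1 hz
  refine ⟨z * (x * y)⁻¹ * x, H.Cmul _ h1 _ hx, y, hy, ?_, rfl, by group⟩
  rw [H.hd, H.hd, d_inv H.hd, H.hd, hdz]; ring

open P2 in
theorem S_ne (H : P1 d B W t) (hS : ∀ r, r ∈ S d (CC B W)) : ∀ x, x ∈ CC B W → x ∈ B := by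
  have htT : t ∈ T d B W := fun w hw b hb hdb => ((H.hW w).1 hw).2 b hb hdb
  suffices hWB : ∀ w ∈ W, w ∈ B by
    rintro _ ⟨w, hw, b, hb, rfl⟩
    exact H.mul _ (hWB w hw) _ hb
  by_cases hT : -t ∈ T d B W
  · obtain ⟨x, hx, hdx, rx⟩ := hS t
    obtain ⟨x', hx', hdx', rx'⟩ := hS (-t)
    have h1 := H.p2.uniq rx (H.p2.rp_inv rx') (by rw [d_inv H.hd, hdx, hdx']; ring) hx
    have hdi : d x'⁻¹ = t := by rw [d_inv H.hd, hdx']; ring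
    rw [H.T_C hT hdx'] at hx'
    rw [H.T_C htT hdi] at h1
    intro w hw
    have := H.mul _ (htT w hw _ h1 hdi) _ hx'
    rwa [inv_mul_cancel_right] at this
  · simp only [T, Set.mem_ofPred_eq] at hT
    push Not at hT
    obtain ⟨w0, hw0, b, hb, hdb, hn⟩ := hT
    obtain ⟨h1, h2, h3, h4⟩ := H.nonT hw0 hb hn
    have d0 := H.dW hw0
    intro w hw
    have h5 : (w0 * b)⁻¹ * w0 * (w0 * b) ∈ W := by
      rw [← h3 _ (by rw [H.hd, H.hd, d_inv H.hd, d0]; ring)]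
      have e : w0 * b * ((w0 * b)⁻¹ * w0 * (w0 * b)) * (w0 * b)⁻¹ = w0 := by group
      rwa [e]
    have h6 := htT _ (H.Wmul hw h5) _ h1 (by rw [d_inv H.hd, H.hd, d0, hdb]; ring)
    have h7 := H.mul _ h6 _ hb
    have e : w * ((w0 * b)⁻¹ * w0 * (w0 * b)) * (w0 * b)⁻¹ * b = w := by group
    rwa [e] at h7

open P2 in
theorem R_ne (H : P1 d B W t) {a b : ℚ} (hab : 0 < a * b) {z : G} (hz : z ∈ B)
    (hdz : d z = a + b)
    (hn : ∀ p ∈ B, ∀ q ∈ B, d p = a → d q = b → p * q ≠ z) : ¬ ∀ r, r ∈ R d (CC B W) := by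
  intro hR
  by_cases hS : ∀ r, r ∈ S d (CC B W)
  · have hB := H.S_ne hS
    obtain ⟨p, hp, q, hq, hdp, hdq, e⟩ := H.prod_S (H.BC hz) hdz (hS a) (hS b)
    exact hn p (hB p hp) q (hB q hq) hdp hdq e
  have hcon : ∀ p q, p ∈ S d (CC B W) → q ∈ S d (CC B W) → ¬ p * q < 0 :=
    fun p q hp hq h => hS (H.p2.S_all hR hp hq h)
  have ha0 : a ≠ 0 := by rintro rfl; simp at hab
  have hb0 : b ≠ 0 := by rintro rfl; simp at hab
  have hT : ∀ r, r ≠ 0 → r ∈ T d B W := by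
    intro r hr
    by_contra h
    obtain ⟨h1, h2⟩ := H.nonT_rp h
    have : 0 < r * r := mul_self_pos.2 hr
    exact hcon _ _ h1 h2 (by linarith)
  suffices h : ∃ p ∈ CC B W, ∃ q ∈ CC B W, d p = a ∧ d q = b ∧ p * q = z by
    obtain ⟨p, hp, q, hq, hdp, hdq, e⟩ := h
    exact hn p ((H.T_C (hT a ha0) hdp).1 hp) q ((H.T_C (hT b hb0) hdq).1 hq) hdp hdq e
  by_cases hSa : a ∈ S d (CC B W)
  · by_cases hSb : b ∈ S d (CC B W)
    · exact H.prod_S (H.BC hz) hdz hSa hSb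
    · have := (H.p2.S_tot (hR b)).resolve_left hSb
      exact absurd (by linarith) (hcon _ _ hSa this)
  · have hSa' := (H.p2.S_tot (hR a)).resolve_left hSa
    have hSb : b ∉ S d (CC B W) := by
      intro h
      exact hcon _ _ hSa' h (by linarith)
    have hSb' := (H.p2.S_tot (hR b)).resolve_left hSb
    obtain ⟨x, rfl, rx⟩ := hR a
    obtain ⟨y, rfl, ry⟩ := hR b
    have h1 := (H.p2.rp_mul rx ry z (by rw [hdz, H.hd])).1 (H.BC hz)
    have hxy : x * y ∉ CC B W := by
      intro h
      have h2 : d x + d y ∈ S d (CC B W) := ⟨_, h, H.hd _ _, H.p2.rp_mul rx ry⟩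
      have : 0 < d x * d x := mul_self_pos.2 ha0
      exact hcon _ _ hSa' h2 (by linarith)
    have h2 : (z * (x * y)⁻¹)⁻¹ ∉ CC B W := by
      intro h
      have := H.Cmul _ h _ (H.BC hz)
      have e : (z * (x * y)⁻¹)⁻¹ * z = x * y := by group
      rw [e] at this
      exact hxy this
    obtain ⟨j1, j2, d1, d2, n1, n2, e⟩ := H.p2.hJ (z * (x * y)⁻¹)
      (by rw [H.hd, d_inv H.hd, H.hd, hdz]; ring) h2
    have hc : (x⁻¹ * j2 * x)⁻¹ ∉ CC B W := by
      intro h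
      have e3 : (x⁻¹ * j2 * x)⁻¹ = x⁻¹ * j2⁻¹ * x := by group
      rw [e3, H.p2.conj' rx (by rw [d_inv H.hd, d2]; ring)] at h
      exact n2 h
    have dc : d (x⁻¹ * j2 * x) = 0 := by rw [H.hd, H.hd, d_inv H.hd, d2]; ring
    refine ⟨j1 * x, H.p2.jx rx d1 n1, x⁻¹ * j2 * x * y, H.p2.jx ry dc hc, ?_, ?_, ?_⟩
    · rw [H.hd, d1]; ring
    · rw [H.hd, dc]; ring
    · have : z = (j1 * j2) * (x * y) := by rw [← e]; group
      rw [this]; group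

open P2 in
theorem main (H : P1 d B W t) {a b : ℚ} (hab : 0 < a * b) {z : G} (hz : z ∈ B)
    (hdz : d z = a + b)
    (hn : ∀ p ∈ B, ∀ q ∈ B, d p = a → d q = b → p * q ≠ z) :
    ∃ l : ℕ, 0 < l ∧ (1 / (l : ℚ)) ∉ R d (CC B W) ∧
      ∃ n : ℕ, 0 < n ∧ (n : ℚ) * (1 / (l : ℚ)) ∈ R d (CC B W) := by
  have h1 := H.R_ne hab hz hdz hn
  push Not at h1
  obtain ⟨r, hr⟩ := h1
  have hu := H.u_mem hz hdz hn
  have hl : (r.den : ℚ) ≠ 0 := by exact_mod_cast r.den_nz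
  refine ⟨r.den, r.den_pos, ?_, ?_⟩
  · intro h
    have := H.p2.R_int h r.num
    rw [mul_one_div, Rat.num_div_den] at this
    exact hr this
  · set u := a + b with hu'
    have hu0 : u ≠ 0 := by
      intro h
      have : b = -a := by linarith
      subst this
      nlinarith [mul_self_nonneg a]
    refine ⟨r.den * u.num.natAbs, Nat.mul_pos r.den_pos
      (Int.natAbs_pos.2 (Rat.num_ne_zero.2 hu0)), ?_⟩
    have h2 := H.p2.R_nat hu u.den
    rw [mul_comm, Rat.mul_den_eq_num] at h2
    have h3 : ((u.num.natAbs : ℕ) : ℚ) ∈ R d (CC B W) := by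
      rcases Int.natAbs_eq u.num with h | h
      · rw [h, Int.cast_natCast] at h2
        simpa using h2
      · have := H.p2.R_neg h2
        rw [h, Int.cast_neg, neg_neg, Int.cast_natCast] at this
        simpa using this
    convert h3 using 1
    push_cast
    field_simp

end P1
end S17
namespace S17

/-- total subring-like sets -/
structure TV (W : Set K) : Prop where
  tot : ∀ k : K, k ≠ 0 → k ∈ W ∨ k⁻¹ ∈ W
  mul : ∀ x ∈ W, ∀ y ∈ W, x * y ∈ W
  add : ∀ x ∈ W, ∀ y ∈ W, x + y ∈ W
  neg : ∀ x ∈ W, -x ∈ W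
  zero : (0 : K) ∈ W
  one : (1 : K) ∈ W

theorem aprod_eq {S T : Set K} (hS : IsAddSubgrp S) (hT0 : (0 : K) ∈ T)
    (hch : ∀ x ∈ T, ∀ y ∈ T, ∃ v, (∀ s ∈ S, s * v ∈ S) ∧ (x = v * y ∨ y = v * x)) :
    aprod S T = S * T := by
  have hneg : ∀ x ∈ S, -x ∈ S := fun x hx => by simpa using hS.2 0 hS.1 x hx
  have hadd : ∀ x ∈ S, ∀ y ∈ S, x + y ∈ S := fun x hx y hy => by
    simpa using hS.2 x hx _ (hneg y hy)
  apply Set.Subset.antisymm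
  · intro x hx
    refine AddSubgroup.closure_induction (p := fun x _ => x ∈ S * T) ?_ ?_ ?_ ?_ hx
    · intro x hx; exact hx
    · exact ⟨0, hS.1, 0, hT0, by simp⟩
    · rintro _ _ _ _ ⟨s, hs, t, ht, rfl⟩ ⟨s', hs', t', ht', rfl⟩
      obtain ⟨v, hv, rfl | rfl⟩ := hch t ht t' ht'
      · exact ⟨s * v + s', hadd _ (hv s hs) _ hs', t', ht', by simp [add_mul, mul_assoc]⟩
      · exact ⟨s + s' * v, hadd _ hs _ (hv s' hs'), t, ht, by simp [add_mul, mul_assoc]⟩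
    · rintro _ _ ⟨s, hs, t, ht, rfl⟩
      exact ⟨-s, hneg s hs, t, ht, by simp⟩
  · exact AddSubgroup.subset_closure

theorem TV.jac_right {W : Set K} (H : TV W) {j w : K} (hj : j ∈ jacS W) (hw : w ∈ W) :
    j * w ∈ jacS W := by
  refine ⟨H.mul _ hj.1 _ hw, ?_⟩
  by_contra hc
  push Not at hc
  have hj0 : j ≠ 0 := by rintro rfl; simp at hc
  have hw0 : w ≠ 0 := by rintro rfl; simp at hc
  have := H.mul _ hw _ hc.2
  rw [mul_inv_rev, mul_inv_cancel_left₀ hw0] at this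
  exact (hj.2.resolve_left hj0) this

theorem TV.jac_left {W : Set K} (H : TV W) {j w : K} (hj : j ∈ jacS W) (hw : w ∈ W) :
    w * j ∈ jacS W := by
  refine ⟨H.mul _ hw _ hj.1, ?_⟩
  by_contra hc
  push Not at hc
  have hj0 : j ≠ 0 := by rintro rfl; simp at hc
  have hw0 : w ≠ 0 := by rintro rfl; simp at hc
  have := H.mul _ hc.2 _ hw
  rw [mul_inv_rev, inv_mul_cancel_right₀ hw0] at this
  exact (hj.2.resolve_left hj0) this

theorem TV.chain {W : Set K} (H : TV W) (x y : K) : ∃ v ∈ W, x = v * y ∨ y = v * x := by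
  rcases eq_or_ne x 0 with rfl | hx
  · exact ⟨0, H.zero, Or.inl (by simp)⟩
  rcases eq_or_ne y 0 with rfl | hy
  · exact ⟨0, H.zero, Or.inr (by simp)⟩
  rcases H.tot (x * y⁻¹) (by simp [hx, hy]) with h | h
  · exact ⟨_, h, Or.inl (by rw [inv_mul_cancel_right₀ hy])⟩
  · exact ⟨_, h, Or.inr (by rw [mul_inv_rev, inv_inv, inv_mul_cancel_right₀ hx])⟩

theorem TV.jac_add {W : Set K} (H : TV W) : IsAddSubgrp (jacS W) := by
  refine ⟨⟨H.zero, Or.inl rfl⟩, fun x hx y hy => ?_⟩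
  obtain ⟨v, hv, rfl | rfl⟩ := H.chain x y
  · have : v * y - y = (v + -1) * y := by rw [add_mul]; simp [sub_eq_add_neg]
    rw [this]
    exact H.jac_left hy (H.add _ hv _ (H.neg _ H.one))
  · have : x - v * x = (1 + -v) * x := by rw [add_mul]; simp [sub_eq_add_neg]
    rw [this]
    exact H.jac_left hx (H.add _ H.one _ (H.neg _ hv))

theorem TV.jac_fac {W : Set K} (H : TV W) (hJ : aprod (jacS W) (jacS W) = jacS W) {j : K}
    (hj0 : j ≠ 0) (hj : j⁻¹ ∉ W) : ∃ j1 j2 : K, j1 ≠ 0 ∧ j2 ≠ 0 ∧ j1 ∈ W ∧ j2 ∈ W ∧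
      j1⁻¹ ∉ W ∧ j2⁻¹ ∉ W ∧ j = j1 * j2 := by
  have hjJ : j ∈ jacS W := ⟨(H.tot j hj0).resolve_right hj, Or.inr hj⟩
  rw [← hJ, aprod_eq H.jac_add H.jac_add.1] at hjJ
  · obtain ⟨j1, h1, j2, h2, e⟩ := hjJ
    dsimp only at e
    have n1 : j1 ≠ 0 := by rintro rfl; simp at e; exact hj0 e.symm
    have n2 : j2 ≠ 0 := by rintro rfl; simp at e; exact hj0 e.symm
    exact ⟨j1, j2, n1, n2, h1.1, h2.1, h1.2.resolve_left n1, h2.2.resolve_left n2, e.symm⟩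
  · intro x _ y _
    obtain ⟨v, hv, h⟩ := H.chain x y
    exact ⟨v, fun s hs => H.jac_right hs hv, h⟩

theorem sub_lstar (I : Set K) : I ⊆ lstar I := by
  intro x hx
  simp only [lstar, Set.mem_iInter]
  intro c hc
  exact hc hx

theorem mem_smul' {W : Set K} {c y : K} (hc : c ≠ 0) : y ∈ W * {c} ↔ y * c⁻¹ ∈ W := by
  constructor
  · rintro ⟨w, hw, c', rfl, rfl⟩
    simpa [mul_assoc, hc] using hw
  · intro h
    exact ⟨_, h, c, rfl, by simp [mul_assoc, hc]⟩

theorem lstar_ne {W I : Set K} (H : TV W) (hI : Ol I = W) (h0 : (0 : K) ∈ I) {c : K}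
    (hc : c ∈ lstar I) (hn : c ∉ I) : c ≠ 0 ∧ (∀ y ∈ I, y * c⁻¹ ∈ W) ∧
      ∀ j, j ≠ 0 → j⁻¹ ∉ W → j * c ∈ I := by
  have key : ∀ c, c ∉ I → ∀ y ∈ I, y * c⁻¹ ∈ W := by
    intro c hn y hy
    have hc0 : c ≠ 0 := by rintro rfl; exact hn h0
    rcases eq_or_ne y 0 with rfl | hy0
    · simpa using H.zero
    refine (H.tot _ (by simp [hy0, hc0])).resolve_right fun h => hn ?_
    rw [← hI] at h
    have := h y hy
    simpa [mul_assoc, hy0] using this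
  have hc0 : c ≠ 0 := by rintro rfl; exact hn h0
  refine ⟨hc0, key c hn, fun j hj0 hj => ?_⟩
  by_contra hjc
  have hjc0 : j * c ≠ 0 := mul_ne_zero hj0 hc0
  simp only [lstar, Set.mem_iInter] at hc
  have := hc (j * c) (by
    intro y hy
    rw [hI, mem_smul' hjc0]
    exact key _ hjc y hy)
  rw [hI, mem_smul' hjc0] at this
  apply hj
  simpa [mul_inv_rev, ← mul_assoc, hc0] using this

theorem lstar_eq {W M : Set K} (H : TV W) (hJ : aprod (jacS W) (jacS W) = jacS W)
    (hWK : ∃ k, k ∉ W)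
    {c : K} (hc : c ≠ 0) (hM : ∀ w ∈ W, ∀ m ∈ M, w * m ∈ M)
    (h1 : ∀ y ∈ M, y * c⁻¹ ∈ W) (h2 : ∀ j, j ≠ 0 → j⁻¹ ∉ W → j * c ∈ M) :
    lstar M = W * {c} := by
  have hO : Ol M = W := by
    apply Set.Subset.antisymm
    · intro a ha
      by_contra hn
      have ha0 : a ≠ 0 := by rintro rfl; exact hn H.zero
      have h3 := ha _ (h2 a⁻¹ (inv_ne_zero ha0) (by simpa using hn))
      rw [mul_inv_cancel_left₀ ha0] at h3
      have h4 := h1 _ (ha _ h3)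
      rw [mul_inv_cancel_right₀ hc] at h4
      exact hn h4
    · exact fun w hw m hm => hM w hw m hm
  apply Set.Subset.antisymm
  · intro x hx
    simp only [lstar, Set.mem_iInter] at hx
    have := hx c (by
      intro y hy
      rw [hO, mem_smul' hc]; exact h1 y hy)
    rwa [hO] at this
  · intro x hx
    simp only [lstar, Set.mem_iInter]
    intro c' hc'
    have hc' : M ⊆ Ol M * {c'} := hc'
    rw [hO] at hc' ⊢
    have hc0 : c' ≠ 0 := by
      rintro rfl
      obtain ⟨k, hk⟩ := hWK
      have hk0 : k ≠ 0 := by rintro rfl; exact hk H.zero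
      obtain ⟨w, _, z, hz, e⟩ := hc' (h2 k⁻¹ (inv_ne_zero hk0) (by simpa using hk))
      rw [Set.mem_singleton_iff] at hz
      subst hz
      have : k⁻¹ * c ≠ 0 := mul_ne_zero (inv_ne_zero hk0) hc
      simp at e
      exact this (by simpa using e)
    rw [mem_smul' hc] at hx
    rw [mem_smul' hc0]
    have h3 : c * c'⁻¹ ∈ W := by
      by_contra hn
      obtain ⟨j1, j2, n1, n2, _, _, m1, m2, e⟩ := H.jac_fac hJ (j := c' * c⁻¹)
        (by simp [hc, hc0]) (by simpa using hn)
      have h4 := hc' (h2 j2 n2 m2)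
      rw [mem_smul' hc0] at h4
      apply m1
      have e2 : c' = j1 * j2 * c := by rw [← e, inv_mul_cancel_right₀ hc]
      have e3 : j2 * c * c'⁻¹ = j1⁻¹ := by
        rw [e2]; simp [mul_inv_rev, ← mul_assoc, hc, n2]
      rwa [e3] at h4
    have := H.mul _ hx _ h3
    simpa [mul_assoc, hc] using this

theorem sig0 {σ : ℚ → (K ≃+* K)} (hσ : ∀ r s : ℚ, σ (r + s) = (σ r).trans (σ s)) (x : K) :
    σ 0 x = x := by
  have := hσ 0 0
  rw [add_zero] at this
  have h := congrArg (fun f : K ≃+* K => f x) this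
  simp only [RingEquiv.trans_apply] at h
  exact (σ 0).injective h.symm

theorem sig_add {σ : ℚ → (K ≃+* K)} (hσ : ∀ r s : ℚ, σ (r + s) = (σ r).trans (σ s)) (r s : ℚ)
    (x : K) : σ (r + s) x = σ r (σ s x) := by
  rw [add_comm, hσ]; rfl

theorem sig_neg {σ : ℚ → (K ≃+* K)} (hσ : ∀ r s : ℚ, σ (r + s) = (σ r).trans (σ s)) (r : ℚ)
    (x : K) : σ r (σ (-r) x) = x := by
  rw [← sig_add hσ, add_neg_cancel, sig0 hσ]

def phi (σ : ℚ → (K ≃+* K)) (hσ : ∀ r s : ℚ, σ (r + s) = (σ r).trans (σ s)) :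
    Multiplicative ℚ →* MulAut Kˣ where
  toFun r := Units.mapEquiv (σ r.toAdd).toMulEquiv
  map_one' := by
    ext x
    exact sig0 hσ _
  map_mul' r s := by
    ext x
    exact sig_add hσ _ _ _

section
variable (σ : ℚ → (K ≃+* K)) (hσ : ∀ r s : ℚ, σ (r + s) = (σ r).trans (σ s))

abbrev GG := SemidirectProduct Kˣ (Multiplicative ℚ) (phi σ hσ)

variable {σ hσ}

def dg (g : GG σ hσ) : ℚ := g.right.toAdd

def el (g : GG σ hσ) : K := (g.left : K)

def mk (r : ℚ) (a : K) (ha : a ≠ 0) : GG σ hσ := ⟨Units.mk0 a ha, Multiplicative.ofAdd r⟩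

theorem dg_mul (g h : GG σ hσ) : dg (g * h) = dg g + dg h := rfl

theorem el_mul (g h : GG σ hσ) : el (g * h) = el g * σ (dg g) (el h) := rfl

theorem dg_mk (r : ℚ) (a : K) (ha : a ≠ 0) : dg (mk r a ha : GG σ hσ) = r := rfl

theorem el_mk (r : ℚ) (a : K) (ha : a ≠ 0) : el (mk r a ha : GG σ hσ) = a := rfl

theorem el_ne (g : GG σ hσ) : el g ≠ 0 := g.left.ne_zero

theorem el_one : el (1 : GG σ hσ) = 1 := rfl

theorem ext' {g h : GG σ hσ} (h1 : dg g = dg h) (h2 : el g = el h) : g = h :=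
  SemidirectProduct.ext (Units.ext h2) h1

theorem el_inv (g : GG σ hσ) : σ (dg g) (el g⁻¹) = (el g)⁻¹ := by
  have := el_mul g g⁻¹
  rw [mul_inv_cancel, el_one] at this
  exact eq_inv_of_mul_eq_one_right this.symm

theorem el_div {g h : GG σ hσ} (e : dg g = dg h) : el (g * h⁻¹) = el g * (el h)⁻¹ := by
  rw [el_mul, e, el_inv]

def BB (σ : ℚ → (K ≃+* K)) (hσ : ∀ r s : ℚ, σ (r + s) = (σ r).trans (σ s)) (A : ℚ → Set K) :
    Set (GG σ hσ) := {g | el g ∈ A (dg g)}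

def WW (σ : ℚ → (K ≃+* K)) (hσ : ∀ r s : ℚ, σ (r + s) = (σ r).trans (σ s)) (W : Set K) :
    Set (GG σ hσ) := {g | dg g = 0 ∧ el g ∈ W}

theorem mem_WW_div {W : Set K} {g h : GG σ hσ} (e : dg g = dg h) :
    g * h⁻¹ ∈ WW σ hσ W ↔ el g * (el h)⁻¹ ∈ W := by
  unfold WW
  rw [Set.mem_ofPred_eq, el_div e, dg_mul, d_inv dg_mul, e]
  simp

theorem el_inv0 {g : GG σ hσ} (e : dg g = 0) : el g⁻¹ = (el g)⁻¹ := by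
  have := el_inv g
  rwa [e, sig0 hσ] at this

theorem exists_g (r : ℚ) (a : K) (ha : a ≠ 0) : ∃ g : GG σ hσ, dg g = r ∧ el g = a :=
  ⟨mk r a ha, rfl, rfl⟩

theorem tvV (V : Subring K) (hV : IsTVR V) : TV (V : Set K) where
  tot := hV
  mul _ hx _ hy := V.mul_mem hx hy
  add _ hx _ hy := V.add_mem hx hy
  neg _ hx := V.neg_mem hx
  zero := V.zero_mem
  one := V.one_mem

theorem mulA {V0 : Set K} {A : ℚ → Set K} (hA : IsGradedExtQ V0 σ A) {r s : ℚ} {x y : K}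
    (hx : x ∈ A r) (hy : y ∈ A s) : x * σ r y ∈ A (r + s) :=
  hA.2.2.2 r trivial s trivial
    (AddSubgroup.subset_closure (Set.mul_mem_mul hx (Set.mem_image_of_mem _ hy)))

theorem aprodA (V : Subring K) (hV : IsTVR V) {A : ℚ → Set K}
    (hA : IsGradedExtQ (V : Set K) σ A) (r s : ℚ) :
    aprod (A r) (σ r '' A s) = A r * (σ r '' A s) := by
  refine aprod_eq (hA.1 r trivial)
    (show (0 : K) ∈ σ r '' A s from ⟨0, (hA.1 s trivial).1, by simp⟩) ?_
  rintro _ ⟨x, hx, rfl⟩ _ ⟨y, hy, rfl⟩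
  obtain ⟨v, hv, h⟩ := (tvV V hV).chain x y
  refine ⟨σ r v, fun a ha => ?_, ?_⟩
  · rw [← hA.2.1] at hv
    simpa using mulA hA ha hv
  · rcases h with h | h
    · left; rw [h, map_mul]
    · right; rw [h, map_mul]

theorem tvW (hσ : ∀ r s : ℚ, σ (r + s) = (σ r).trans (σ s)) (V : Subring K) (hV : IsTVR V)
    {A : ℚ → Set K} (hA : IsGradedExtQ (V : Set K) σ A) (t : ℚ) : TV (Ol (A t)) := by
  have hS := hA.1 t trivial
  have hneg : ∀ x ∈ A t, -x ∈ A t := fun x hx => by simpa using hS.2 0 hS.1 x hx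
  have hadd : ∀ x ∈ A t, ∀ y ∈ A t, x + y ∈ A t := fun x hx y hy => by
    simpa using hS.2 x hx _ (hneg y hy)
  have hVW : ∀ v ∈ V, v ∈ Ol (A t) := by
    intro v hv x hx
    have hv : v ∈ (V : Set K) := hv
    rw [← hA.2.1] at hv
    have := mulA hA hv hx
    rwa [zero_add, sig0 hσ] at this
  refine ⟨fun k hk => (hV k hk).imp (hVW _) (hVW _), ?_, ?_, ?_, hVW _ V.zero_mem,
    hVW _ V.one_mem⟩
  · intro x hx y hy a ha
    rw [mul_assoc]; exact hx _ (hy _ ha)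
  · intro x hx y hy a ha
    rw [add_mul]; exact hadd _ (hx _ ha) _ (hy _ ha)
  · intro x hx a ha
    rw [neg_mul]; exact hneg _ (hx _ ha)

theorem ol_iff {A : ℚ → Set K} (hA0 : ∀ r, (0 : K) ∈ A r) (r : ℚ) {g : GG σ hσ} (hg : dg g = 0) :
    (∀ y ∈ BB σ hσ A, dg y = r → g * y ∈ BB σ hσ A) ↔ el g ∈ Ol (A r) := by
  constructor
  · intro h x hx
    rcases eq_or_ne x 0 with rfl | hx0
    · simpa using hA0 r
    obtain ⟨y, hy, rfl⟩ := exists_g (hσ := hσ) r x hx0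
    have h1 : el (g * y) ∈ A (dg (g * y)) := h y (by subst hy; exact hx) hy
    rwa [el_mul, dg_mul, hg, zero_add, sig0 hσ, hy] at h1
  · intro h y hy hdy
    have hy : el y ∈ A (dg y) := hy
    change el (g * y) ∈ A (dg (g * y))
    rw [el_mul, dg_mul, hg, zero_add, sig0 hσ]
    subst hdy
    exact h _ hy

theorem mkP1 (V : Subring K) (hV : IsTVR V)
    {A : ℚ → Set K} (hA : IsGradedExtQ (V : Set K) σ A)
    {W : Set K} (hW : W = ⋃ r : ℚ, Ol (A r))
    (hJ : aprod (jacS W) (jacS W) = jacS W)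
    {t : ℚ} (ht : Ol (A t) = W) : P1 dg (BB σ hσ A) (WW σ hσ W) t where
  hd := dg_mul
  mul x hx y hy := mulA hA hx hy
  tot g := by
    have : el g ∈ A (dg g) ∪ (σ (dg g) '' invS (A (-dg g))) := by
      rw [hA.2.2.1 _ trivial]; trivial
    rcases this with h | ⟨_, ⟨c, hc, hc0, rfl⟩, h⟩
    · exact Or.inl h
    · right
      change el g⁻¹ ∈ A (dg g⁻¹)
      rw [d_inv dg_mul]
      have : el g⁻¹ = c := by
        apply (σ (dg g)).injective
        rw [el_inv, ← h, map_inv₀, inv_inv]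
      rwa [this]
  surj r := ⟨mk r 1 one_ne_zero, rfl⟩
  hW a := by
    constructor
    · rintro ⟨h1, h2⟩
      exact ⟨h1, (ol_iff (fun r => (hA.1 r trivial).1) t h1).2 (by rwa [ht])⟩
    · rintro ⟨h1, h2⟩
      exact ⟨h1, by rw [← ht]; exact (ol_iff (fun r => (hA.1 r trivial).1) t h1).1 h2⟩
  hmax r a ha h := by
    refine ⟨ha, ?_⟩
    rw [hW]
    exact Set.mem_iUnion.2 ⟨r, (ol_iff (fun r => (hA.1 r trivial).1) r ha).1 h⟩
  hJ := by
    rintro j ⟨hj0, hj⟩ hn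
    have hT : TV W := by rw [← ht]; exact tvW hσ V hV hA t
    have hji : (el j)⁻¹ ∉ W := by
      intro h
      refine hn ⟨by rw [d_inv dg_mul, hj0]; ring, by rwa [el_inv0 hj0]⟩
    obtain ⟨j1, j2, n1, n2, w1, w2, m1, m2, e⟩ := hT.jac_fac hJ (el_ne j) hji
    refine ⟨mk 0 j1 n1, ⟨rfl, w1⟩, mk 0 j2 n2, ⟨rfl, w2⟩, ?_, ?_, ?_⟩
    · rintro ⟨_, h⟩
      rw [el_inv0 rfl] at h
      exact m1 h
    · rintro ⟨_, h⟩
      rw [el_inv0 rfl] at h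
      exact m2 h
    · apply ext'
      · rw [hj0, dg_mul, dg_mk, dg_mk]; simp
      · rw [e, el_mul, dg_mk, sig0 hσ, el_mk, el_mk]

theorem prod_iff {A : ℚ → Set K} {a b : ℚ} {g : GG σ hσ} (hg : dg g = a + b) :
    el g ∈ A a * (σ a '' A b) ↔
      ∃ p ∈ BB σ hσ A, ∃ q ∈ BB σ hσ A, dg p = a ∧ dg q = b ∧ p * q = g := by
  constructor
  · rintro ⟨x, hx, _, ⟨y, hy, rfl⟩, e⟩
    dsimp only at e
    have hx0 : x ≠ 0 := by rintro rfl; apply el_ne g; rw [← e]; simp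
    have hy0 : y ≠ 0 := by rintro rfl; apply el_ne g; rw [← e]; simp
    refine ⟨mk a x hx0, hx, mk b y hy0, hy, rfl, rfl, ext' ?_ ?_⟩
    · rw [hg]; rfl
    · rw [← e]; rfl
  · rintro ⟨p, hp, q, hq, rfl, rfl, rfl⟩
    exact ⟨_, hp, _, ⟨_, hq, rfl⟩, rfl⟩

theorem exists_z (V : Subring K) (hV : IsTVR V)
    {A : ℚ → Set K} (hA : IsGradedExtQ (V : Set K) σ A) {a b : ℚ}
    (h : aprod (A a) (σ a '' A b) ≠ A (a + b)) :
    ∃ z ∈ BB σ hσ A, dg z = a + b ∧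
      ∀ p ∈ BB σ hσ A, ∀ q ∈ BB σ hσ A, dg p = a → dg q = b → p * q ≠ z := by
  have hs := hA.2.2.2 a trivial b trivial
  obtain ⟨z, hz, hn⟩ := Set.exists_of_ssubset (hs.ssubset_of_ne h)
  have hz0 : z ≠ 0 := by
    rintro rfl
    exact hn (AddSubgroup.zero_mem _)
  refine ⟨mk _ z hz0, hz, rfl, fun p hp q hq hdp hdq e => hn ?_⟩
  rw [aprodA V hV hA]
  exact (prod_iff (g := mk (a + b) z hz0) rfl).2 ⟨p, hp, q, hq, hdp, hdq, e⟩

theorem final (V : Subring K) (hV : IsTVR V)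
    {A : ℚ → Set K} (hA : IsGradedExtQ (V : Set K) σ A)
    {W : Set K} (hW : W = ⋃ r : ℚ, Ol (A r))
    (hJ : aprod (jacS W) (jacS W) = jacS W)
    {t : ℚ} (ht : Ol (A t) = W) {ρ : ℚ}
    (hρ : ρ ∉ P2.R dg (CC (BB σ hσ A) (WW σ hσ W)))
    (hn : ∃ n : ℕ, 0 < n ∧ (n : ℚ) * ρ ∈ P2.R dg (CC (BB σ hσ A) (WW σ hσ W))) :
    HrTypeH (V : Set K) σ A ρ ∧ Ol (A ρ) = W := by
  have H := mkP1 (hσ := hσ) V hV hA hW hJ ht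
  have hT : TV W := by rw [← ht]; exact tvW hσ V hV hA t
  have hA0 : ∀ r, (0 : K) ∈ A r := fun r => (hA.1 r trivial).1
  have tC : ∀ {r : ℚ}, r ∈ P1.T dg (BB σ hσ A) (WW σ hσ W) → ∀ w ∈ W, ∀ x ∈ A r, w * x ∈ A r := by
    intro r hr w hw x hx
    rcases eq_or_ne w 0 with rfl | hw0
    · simpa using hA0 r
    refine (ol_iff hA0 r (g := (mk 0 w hw0 : GG σ hσ)) rfl).1 ?_ x hx
    intro y hy hdy
    exact hr (mk 0 w hw0) ⟨rfl, hw⟩ y hy hdy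
  have hCdiv : ∀ {g h : GG σ hσ}, dg g = dg h →
      (g * h⁻¹ ∈ CC (BB σ hσ A) (WW σ hσ W) ↔ el g * (el h)⁻¹ ∈ W) := by
    intro g h e
    rw [H.C0 (by rw [dg_mul, d_inv dg_mul, e]; ring), mem_WW_div e]
  have hρT := H.nR_T hρ
  have hOl : Ol (A ρ) = W := by
    apply Set.Subset.antisymm
    · rw [hW]; exact Set.subset_iUnion (fun r => Ol (A r)) ρ
    · exact fun w hw x hx => tC hρT w hw x hx
  have hWK : ∃ k, k ∉ W := by
    by_contra hc
    push Not at hc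
    refine hρ ⟨mk ρ 1 one_ne_zero, rfl, fun y hy => ⟨fun _ => ?_, fun h => ?_⟩⟩
    · rw [hCdiv hy]; exact hc _
    · rw [hCdiv hy.symm] at h; exact absurd (hc _) h
  refine ⟨⟨?_, ?_⟩, hOl⟩
  · refine Set.Subset.antisymm ?_ (sub_lstar _)
    intro c hc
    by_contra hcn
    obtain ⟨hc0, h1, h2⟩ := lstar_ne hT hOl (hA0 ρ) hc hcn
    refine hρ ⟨mk ρ c hc0, rfl, fun y hy => ⟨fun h => ?_, fun h => ?_⟩⟩
    · rw [hCdiv hy]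
      rw [H.T_C hρT hy] at h
      have h : el y ∈ A (dg y) := h
      rw [hy] at h
      exact h1 _ h
    · rw [hCdiv hy.symm, el_mk] at h
      rw [H.T_C hρT hy]
      change el y ∈ A (dg y)
      rw [hy]
      have := h2 (el y * c⁻¹) (by simp [el_ne, hc0]) (by simpa using h)
      rwa [inv_mul_cancel_right₀ hc0] at this
  · classical
    set n := Nat.find hn with hn_def
    obtain ⟨hn0, hnR⟩ := Nat.find_spec hn
    have hmin : ∀ k : ℕ, 0 < k → k < n → (k : ℚ) * ρ ∉ P2.R dg (CC (BB σ hσ A) (WW σ hσ W)) :=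
      fun k hk hkn hR => Nat.find_min hn hkn ⟨hk, hR⟩
    have hn1 : n ≠ 1 := by
      intro h
      rw [← hn_def, h] at hnR
      exact hρ (by simpa using hnR)
    obtain ⟨m, hm⟩ : ∃ m, n = m + 2 := ⟨n - 2, by omega⟩
    have hMir : ∀ k, k + 1 < n → Mir (V : Set K) σ A ρ (k + 1) = A (((k + 1 : ℕ) : ℚ) * ρ) := by
      intro k
      induction k with
      | zero => intro _; simp [Mir]
      | succ k ih =>
        intro hk
        have e : ((k + 1 + 1 : ℕ) : ℚ) * ρ = ((k + 1 : ℕ) : ℚ) * ρ + ρ := by push_cast; ring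
        rw [Mir, ih (by omega), e]
        by_contra hne
        obtain ⟨z, hz, hdz, hz2⟩ := exists_z (hσ := hσ) V hV hA hne
        have := H.u_mem hz hdz hz2
        rw [← e] at this
        exact hmin _ (by omega) hk this
    rw [← hn_def, hm] at hnR
    refine ⟨m + 2, by omega, ?_⟩
    have e : ((m + 2 : ℕ) : ℚ) * ρ = ((m + 1 : ℕ) : ℚ) * ρ + ρ := by push_cast; ring
    rw [Mir, hMir m (by omega), aprodA V hV hA, hOl]
    have haT := H.nR_T (hmin (m + 1) (by omega) (by omega))
    rw [e] at hnR
    generalize ((m + 1 : ℕ) : ℚ) * ρ = a at haT hnR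
    have hpr : ∀ y : GG σ hσ, dg y = a + ρ →
        ((∃ p ∈ CC (BB σ hσ A) (WW σ hσ W), ∃ q ∈ CC (BB σ hσ A) (WW σ hσ W),
          dg p = a ∧ dg q = ρ ∧ p * q = y) ↔ el y ∈ A a * (σ a '' A ρ)) := by
      intro y hy
      rw [prod_iff hy]
      constructor
      · rintro ⟨p, hp, q, hq, hdp, hdq, e⟩
        exact ⟨p, (H.T_C haT hdp).1 hp, q, (H.T_C hρT hdq).1 hq, hdp, hdq, e⟩
      · rintro ⟨p, hp, q, hq, hdp, hdq, e⟩
        exact ⟨p, H.BC hp, q, H.BC hq, hdp, hdq, e⟩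
    have key : ∃ x : GG σ hσ, dg x = a + ρ ∧ ∀ y, dg y = a + ρ →
        (el y ∈ A a * (σ a '' A ρ) → y * x⁻¹ ∈ CC (BB σ hσ A) (WW σ hσ W)) ∧
        (x * y⁻¹ ∉ CC (BB σ hσ A) (WW σ hσ W) → el y ∈ A a * (σ a '' A ρ)) := by
      rcases H.p2.dich a ρ with h | ⟨z, hzC, hdz, hzR, h⟩
      · obtain ⟨x, hdx, hx⟩ := hnR
        refine ⟨x, hdx, fun y hy => ?_⟩
        have hyx := hx y (hy.trans hdx.symm)
        rw [← hpr y hy]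
        refine ⟨?_, fun h1 => h y (hyx.2 h1) hy⟩
        rintro ⟨p, hp, q, hq, _, _, rfl⟩
        exact hyx.1 (H.Cmul _ hp _ hq)
      · refine ⟨z, hdz, fun y hy => ?_⟩
        have hyx := hzR y (hy.trans hdz.symm)
        rw [← hpr y hy]
        refine ⟨?_, fun h1 => (h y hy).1 h1⟩
        rintro ⟨p, hp, q, hq, _, _, rfl⟩
        exact hyx.1 (H.Cmul _ hp _ hq)
    obtain ⟨x, hdx, hx⟩ := key
    refine ⟨el x, lstar_eq hT hJ hWK (el_ne x) ?_ ?_ ?_⟩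
    · rintro w hw _ ⟨s, hs, u, hu, rfl⟩
      exact ⟨w * s, tC haT w hw s hs, u, hu, by simp [mul_assoc]⟩
    · intro y hy
      rcases eq_or_ne y 0 with rfl | hy0
      · simpa using hT.zero
      have := (hx (mk (a + ρ) y hy0) rfl).1 hy
      rwa [hCdiv (by rw [hdx]; rfl)] at this
    · intro j hj0 hj
      have := (hx (mk (a + ρ) (j * el x) (mul_ne_zero hj0 (el_ne x))) rfl).2 (by
        rw [hCdiv (by rw [hdx]; rfl), el_mk]
        simpa [mul_inv_rev, ← mul_assoc, el_ne] using hj)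
      exact this

end
end S17
/-- For a graded extension of Type (h) with `O_l(A_t) = W` for some `t`, there is a positive
integer `l` such that `H_{1/l}` is a graded extension of `V` of Type (h) with `O_l(A_{1/l}) = W`. -/
theorem stmt17 (V : Subring K) (hV : IsTVR V) (hVK : (V : Set K) ≠ Set.univ)
    (σ : ℚ → (K ≃+* K)) (hσ : ∀ r s : ℚ, σ (r + s) = (σ r).trans (σ s))
    (A : ℚ → Set K) (hA : IsGradedExtQ (V : Set K) σ A)
    (W : Set K) (hW : W = ⋃ r : ℚ, Ol (A r))
    (hII : ∃ r : ℚ, 0 < r ∧ ¬ HrTypeI σ A r)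
    (hJ : aprod (jacS W) (jacS W) = jacS W)
    (t : ℚ) (ht : Ol (A t) = W) :
    ∃ l : ℕ, 0 < l ∧ IsGradedExtHr (V : Set K) σ A (1 / (l : ℚ)) ∧
      HrTypeH (V : Set K) σ A (1 / (l : ℚ)) ∧ Ol (A (1 / (l : ℚ))) = W := by
  have hz : ∃ a b : ℚ, 0 < a * b ∧ aprod (A a) (σ a '' A b) ≠ A (a + b) := by
    obtain ⟨r, hr, hI⟩ := hII
    by_contra hc
    push Not at hc
    apply hI
    intro i j hi hj
    have hi' : (0 : ℚ) < i := by exact_mod_cast hi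
    have hj' : (0 : ℚ) < j := by exact_mod_cast hj
    have hp : 0 < ((i : ℚ) * r) * ((j : ℚ) * r) := by positivity
    constructor
    · rw [hc _ _ hp]
      congr 1
      push_cast; ring
    · rw [hc _ _ (by rwa [neg_mul_neg])]
      congr 1
      push_cast; ring
  obtain ⟨a, b, hab, hne⟩ := hz
  obtain ⟨z, hzB, hdz, hzn⟩ := S17.exists_z (hσ := hσ) V hV hA hne
  obtain ⟨l, hl, hlR, hn⟩ := (S17.mkP1 (hσ := hσ) V hV hA hW hJ ht).main hab hzB hdz hzn
  obtain ⟨h1, h2⟩ := S17.final V hV hA hW hJ ht hlR hn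
  refine ⟨l, hl, ?_, h1, h2⟩
  exact ⟨fun r _ => hA.1 r trivial, hA.2.1, fun r _ => hA.2.2.1 r trivial,
    fun r _ s _ => hA.2.2.2 r trivial s trivial⟩
end

section
/- Let (A_r)_{r∈ℚ} be a family of additive subgroups of K with A_0 = V, W_r = O_l(A_r), W = ∪_{r∈ℚ} W_r, J(W)² = J(W), and assume there is t ∈ ℚ with O_l(A_t) = W. Let H = {r ∈ ℚ : *(J(W)A_r) = Wc_r for some c_r ∈ K}. Then (A_r)_{r∈ℚ} is a graded extension of V in K[ℚ,σ] of Type (h) if and only if for all r, s ∈ H, writing *(J(W)A_s) = Wc_s, one has Wc_s = c_s W^{σ(s)}, Wc_{-s} = W(c_s⁻¹)^{σ(-s)} and (Wc_r)(Wc_s)^{σ(r)} = Wc_{r+s}, and moreover: (1) H is a nonzero proper additive subgroup of ℚ and the family (A_s)_{s∈H} is a graded extension of V in K[H, σ|_H]; (2) for every s ∉ H, *A_s = A_s = WA_s is not a principal left W-ideal and O_r(A_s) = W^{σ(s)}; (3) the family (M_r)_{r∈ℚ} defined by M_0 = V, M_{-s} = Wc_{-s} and M_s = J(W)c_s for s ∈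 H with s > 0, and M_r = A_r for r ∉ H, is a graded extension of V in K[ℚ,σ]. -/
open scoped Pointwise

variable {K : Type*} [DivisionRing K]

namespace GX

abbrev Sm (K : Type*) [DivisionRing K] := Submodule ℤ K

def T (f : K ≃+* K) (P : Sm K) : Sm K := P.map (f : K →+* K).toIntAlgHom.toLinearMap

theorem mem_T {f : K ≃+* K} {P : Sm K} {x : K} : x ∈ T f P ↔ f.symm x ∈ P := by
  constructor
  · rintro ⟨y, hy, rfl⟩
    simpa using hy
  · intro h
    exact ⟨_, h, by simp⟩

theorem mem_T' {f : K ≃+* K} {P : Sm K} {x : K} : f x ∈ T f P ↔ x ∈ P := by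
  rw [mem_T]; simp

theorem T_mul (f : K ≃+* K) (P Q : Sm K) : T f (P * Q) = T f P * T f Q :=
  Submodule.map_mul _ _ _

theorem T_mono (f : K ≃+* K) {P Q : Sm K} (h : P ≤ Q) : T f P ≤ T f Q :=
  Submodule.map_mono h

theorem coe_T (f : K ≃+* K) (P : Sm K) : ((T f P : Sm K) : Set K) = f '' (P : Set K) := by
  ext x; simp [T]

theorem coe_mul (P Q : Sm K) : ((P * Q : Sm K) : Set K) = aprod (P : Set K) (Q : Set K) := by
  apply Set.Subset.antisymm
  · have : P * Q ≤ AddSubgroup.toIntSubmodule (AddSubgroup.closure ((P : Set K) * (Q : Set K))) := by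
      rw [Submodule.mul_le]
      intro m hm n hn
      exact AddSubgroup.subset_closure (Set.mul_mem_mul hm hn)
    exact this
  · have : AddSubgroup.closure ((P : Set K) * (Q : Set K)) ≤ (P * Q : Sm K).toAddSubgroup := by
      rw [AddSubgroup.closure_le]
      rintro x ⟨m, hm, n, hn, rfl⟩
      exact Submodule.mul_mem_mul hm hn
    exact this

def toSm (S : Set K) (h : IsAddSubgrp S) : Sm K :=
  AddSubgroup.toIntSubmodule (AddSubgroup.ofSub S ⟨0, h.1⟩ (fun {x} hx {y} hy => by
    simpa [sub_eq_add_neg] using h.2 x hx y hy))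

theorem coe_toSm (S : Set K) (h : IsAddSubgrp S) : (toSm S h : Set K) = S := rfl

theorem isAddSubgrp (P : Sm K) : IsAddSubgrp (P : Set K) :=
  ⟨P.zero_mem, fun _ hx _ hy => P.sub_mem hx hy⟩

/-- principal -/
def sp (c : K) : Sm K := Submodule.span ℤ {c}

theorem mem_mul_sp {P : Sm K} {c x : K} : x ∈ P * sp c ↔ ∃ p ∈ P, p * c = x := by
  constructor
  · intro h
    have : P * sp c ≤ P.map (LinearMap.mulRight ℤ c) := by
      rw [Submodule.mul_le]
      intro m hm n hn
      obtain ⟨k, rfl⟩ := Submodule.mem_span_singleton.1 hn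
      exact ⟨k • m, P.smul_mem k hm, by simp [-zsmul_eq_mul]⟩
    obtain ⟨p, hp, h2⟩ := this h
    exact ⟨p, hp, by simpa using h2⟩
  · rintro ⟨p, hp, rfl⟩
    exact Submodule.mul_mem_mul hp (Submodule.mem_span_singleton_self c)

theorem mem_sp_mul {P : Sm K} {c x : K} : x ∈ sp c * P ↔ ∃ p ∈ P, c * p = x := by
  constructor
  · intro h
    have : sp c * P ≤ P.map (LinearMap.mulLeft ℤ c) := by
      rw [Submodule.mul_le]
      intro n hn m hm
      obtain ⟨k, rfl⟩ := Submodule.mem_span_singleton.1 hn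
      exact ⟨k • m, P.smul_mem k hm, by simp [-zsmul_eq_mul]⟩
    obtain ⟨p, hp, h2⟩ := this h
    exact ⟨p, hp, by simpa using h2⟩
  · rintro ⟨p, hp, rfl⟩
    exact Submodule.mul_mem_mul (Submodule.mem_span_singleton_self c) hp

theorem coe_mul_sp (P : Sm K) (c : K) : ((P * sp c : Sm K) : Set K) = (P : Set K) * {c} := by
  ext x; rw [SetLike.mem_coe, mem_mul_sp]; simp

theorem coe_sp_mul (P : Sm K) (c : K) : ((sp c * P : Sm K) : Set K) = {c} * (P : Set K) := by
  ext x; rw [SetLike.mem_coe, mem_sp_mul]; simp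

theorem sp_mul_sp (c d : K) : sp c * sp d = sp (c * d) := by
  simp [sp, Submodule.span_mul_span]

theorem sp_one : sp (1 : K) = 1 := Submodule.one_eq_span.symm

theorem T_sp (f : K ≃+* K) (c : K) : T f (sp c) = sp (f c) := by
  simp [T, sp, Submodule.map_span]

theorem sp_cancel (P : Sm K) {c : K} (hc : c ≠ 0) : P * sp c * sp c⁻¹ = P := by
  rw [mul_assoc, sp_mul_sp, mul_inv_cancel₀ hc, sp_one, mul_one]

theorem sp_cancel' (P : Sm K) {c : K} (hc : c ≠ 0) : P * sp c⁻¹ * sp c = P := by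
  rw [mul_assoc, sp_mul_sp, inv_mul_cancel₀ hc, sp_one, mul_one]

theorem cancel_sp (P : Sm K) {c : K} (hc : c ≠ 0) : sp c⁻¹ * (sp c * P) = P := by
  rw [← mul_assoc, sp_mul_sp, inv_mul_cancel₀ hc, sp_one, one_mul]

theorem cancel_sp' (P : Sm K) {c : K} (hc : c ≠ 0) : sp c * (sp c⁻¹ * P) = P := by
  rw [← mul_assoc, sp_mul_sp, mul_inv_cancel₀ hc, sp_one, one_mul]

structure TV (W : Sm K) : Prop where
  one : (1 : K) ∈ W
  mul : ∀ x ∈ W, ∀ y ∈ W, x * y ∈ W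
  tot : ∀ k : K, k ≠ 0 → k ∈ W ∨ k⁻¹ ∈ W

section tv
variable {W : Sm K} (h : TV W)

theorem jac_mul_left (h : TV W) {x y : K} (hx : x ∈ W) (hy : y ∈ jacS (W : Set K)) :
    x * y ∈ jacS (W : Set K) := by
  refine ⟨h.mul x hx y hy.1, ?_⟩
  by_cases h0 : x * y = 0
  · exact Or.inl h0
  · right
    intro h1
    have hx0 : x ≠ 0 := left_ne_zero_of_mul h0
    have hy0 : y ≠ 0 := right_ne_zero_of_mul h0
    rcases hy.2 with h2 | h2
    · exact hy0 h2
    · apply h2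
      have := h.mul _ h1 _ hx
      rwa [mul_inv_rev, mul_assoc, inv_mul_cancel₀ hx0, mul_one] at this

theorem jac_mul_right (h : TV W) {x y : K} (hx : x ∈ jacS (W : Set K)) (hy : y ∈ W) :
    x * y ∈ jacS (W : Set K) := by
  refine ⟨h.mul x hx.1 y hy, ?_⟩
  by_cases h0 : x * y = 0
  · exact Or.inl h0
  · right
    intro h1
    have hx0 : x ≠ 0 := left_ne_zero_of_mul h0
    have hy0 : y ≠ 0 := right_ne_zero_of_mul h0
    rcases hx.2 with h2 | h2
    · exact hx0 h2
    · apply h2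
      have := h.mul _ hy _ h1
      rwa [mul_inv_rev, ← mul_assoc, mul_inv_cancel₀ hy0, one_mul] at this

theorem jac_grp (h : TV W) : IsAddSubgrp (jacS (W : Set K)) := by
  refine ⟨⟨W.zero_mem, Or.inl rfl⟩, ?_⟩
  intro x hx y hy
  have hneg : ∀ z ∈ jacS (W : Set K), -z ∈ jacS (W : Set K) := by
    intro z hz
    have := jac_mul_left h (W.neg_mem h.one) hz
    simpa using this
  by_cases hx0 : x = 0
  · subst hx0; simpa using hneg y hy
  by_cases hy0 : y = 0
  · subst hy0; simpa using hx
  rcases h.tot (x * y⁻¹) (mul_ne_zero hx0 (inv_ne_zero hy0)) with h1 | h1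
  · have := jac_mul_left h (W.sub_mem h1 h.one) hy
    rwa [sub_mul, mul_assoc, inv_mul_cancel₀ hy0, mul_one, one_mul] at this
  · rw [mul_inv_rev, inv_inv] at h1
    have := jac_mul_left h (W.sub_mem h.one h1) hx
    rwa [sub_mul, mul_assoc, inv_mul_cancel₀ hx0, mul_one, one_mul] at this

/-- the Jacobson radical as a submodule -/
def Jm (W : Sm K) (h : TV W) : Sm K := toSm _ (jac_grp h)

theorem coe_Jm : ((Jm W h : Sm K) : Set K) = jacS (W : Set K) := rfl

theorem Jm_le : Jm W h ≤ W := fun _ hx => hx.1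

theorem W_mul_J : W * Jm W h = Jm W h := by
  apply le_antisymm
  · rw [Submodule.mul_le]; intro m hm n hn; exact jac_mul_left h hm hn
  · intro x hx; have := Submodule.mul_mem_mul h.one hx; rwa [one_mul] at this

theorem J_mul_W : Jm W h * W = Jm W h := by
  apply le_antisymm
  · rw [Submodule.mul_le]; intro m hm n hn; exact jac_mul_right h hm hn
  · intro x hx; have := Submodule.mul_mem_mul hx h.one; rwa [mul_one] at this

theorem W_mul_W (h : TV W) : W * W = W := by
  apply le_antisymm
  · rw [Submodule.mul_le]; exact h.mul
  · intro x hx; have := Submodule.mul_mem_mul hx h.one; rwa [mul_one] at this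

theorem one_notMem_J : (1 : K) ∉ Jm W h := by
  rintro ⟨_, h1 | h1⟩
  · exact one_ne_zero h1
  · rw [inv_one] at h1; exact h1 h.one

theorem inv_mem_J {x : K} (hx : x ∉ W) : x⁻¹ ∈ Jm W h := by
  have hx0 : x ≠ 0 := by rintro rfl; exact hx W.zero_mem
  refine ⟨(h.tot x hx0).resolve_left hx, Or.inr ?_⟩
  rwa [inv_inv]

theorem inv_mem_W {x : K} (hx : x ∉ Jm W h) : x⁻¹ ∈ W := by
  by_contra h1
  have := inv_mem_J h h1
  rw [inv_inv] at this
  exact hx this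

theorem inv_notMem_W {x : K} (hx : x ∈ Jm W h) (hx0 : x ≠ 0) : x⁻¹ ∉ W :=
  hx.2.resolve_left hx0

/-- total order of left ideals -/
theorem le_of_notMem {I : Sm K} (hI : W * I ≤ I) {x : K} (hx : x ∉ I) : I ≤ Jm W h * sp x := by
  intro y hy
  have hx0 : x ≠ 0 := by rintro rfl; exact hx I.zero_mem
  rw [mem_mul_sp]
  refine ⟨y * x⁻¹, ?_, by rw [mul_assoc, inv_mul_cancel₀ hx0, mul_one]⟩
  by_contra h1
  have h2 := inv_mem_W h h1
  have hy0 : y ≠ 0 := by rintro rfl; apply h1; rw [zero_mul]; exact Submodule.zero_mem _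
  rw [mul_inv_rev, inv_inv] at h2
  have := hI (Submodule.mul_mem_mul h2 hy)
  rw [mul_assoc, inv_mul_cancel₀ hy0, mul_one] at this
  exact hx this

theorem le_of_notMem' (h : TV W) {I : Sm K} (hI : W * I ≤ I) {x : K} (hx : x ∉ I) : I ≤ W * sp x :=
  (le_of_notMem h hI hx).trans (mul_le_mul_left (Jm_le h) _)

theorem mem_Ol_J {a : K} (ha : ∀ x ∈ Jm W h, a * x ∈ Jm W h) : a ∈ W := by
  by_contra h1
  have h0 : a ≠ 0 := by rintro rfl; exact h1 W.zero_mem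
  have := ha _ (inv_mem_J h h1)
  rw [mul_inv_cancel₀ h0] at this
  exact one_notMem_J h this

theorem mem_Or_J {a : K} (ha : ∀ x ∈ Jm W h, x * a ∈ Jm W h) : a ∈ W := by
  by_contra h1
  have h0 : a ≠ 0 := by rintro rfl; exact h1 W.zero_mem
  have := ha _ (inv_mem_J h h1)
  rw [inv_mul_cancel₀ h0] at this
  exact one_notMem_J h this

theorem mem_sp_iff {P : Sm K} {c x : K} (hc : c ≠ 0) : x ∈ P * sp c ↔ x * c⁻¹ ∈ P := by
  rw [mem_mul_sp]
  constructor
  · rintro ⟨p, hp, rfl⟩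
    rwa [mul_assoc, mul_inv_cancel₀ hc, mul_one]
  · intro h
    exact ⟨_, h, by rw [mul_assoc, inv_mul_cancel₀ hc, mul_one]⟩

theorem sp_mem_iff {P : Sm K} {c x : K} (hc : c ≠ 0) : x ∈ sp c * P ↔ c⁻¹ * x ∈ P := by
  rw [mem_sp_mul]
  constructor
  · rintro ⟨p, hp, rfl⟩
    rwa [← mul_assoc, inv_mul_cancel₀ hc, one_mul]
  · intro h
    exact ⟨_, h, by rw [← mul_assoc, mul_inv_cancel₀ hc, one_mul]⟩

theorem Ol_eq_of {I : Sm K} (hI : W * I ≤ I) (h2 : ∀ a, (∀ x ∈ I, a * x ∈ I) → a ∈ W) :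
    Ol (I : Set K) = W := by
  ext a
  constructor
  · intro ha; exact h2 a ha
  · intro ha x hx; exact hI (Submodule.mul_mem_mul ha hx)

theorem Ol_Jsp {c : K} (hc : c ≠ 0) : Ol ((Jm W h * sp c : Sm K) : Set K) = W := by
  apply Ol_eq_of
  · rw [← mul_assoc, W_mul_J]
  · intro a ha
    apply mem_Ol_J h
    intro x hx
    have h1 := ha (x * c) (mem_mul_sp.2 ⟨x, hx, rfl⟩)
    rw [mem_sp_iff hc, mul_assoc, mul_assoc, mul_inv_cancel₀ hc, mul_one] at h1
    exact h1

theorem subset_lstar (I : Set K) : I ⊆ lstar I := by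
  intro x hx
  simp only [lstar, Set.mem_iInter]
  intro c hc
  exact hc hx

theorem lstar_subset {I : Set K} {c : K} (hc : I ⊆ Ol I * {c}) : lstar I ⊆ Ol I * {c} := by
  intro x hx
  simp only [lstar, Set.mem_iInter] at hx
  exact hx c hc

theorem J_nonprincipal (hJ : Jm W h * Jm W h = Jm W h) (hne : ∃ x, x ∉ W) {c : K}
    (hc : Jm W h ≤ W * sp c) : W ≤ W * sp c := by
  by_cases h1 : c ∈ Jm W h
  · exfalso
    have h2 : Jm W h ≤ Jm W h * sp c := by
      calc Jm W h = Jm W h * Jm W h := hJ.symm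
        _ ≤ Jm W h * (W * sp c) := mul_le_mul_right hc _
        _ = Jm W h * sp c := by rw [← mul_assoc, J_mul_W]
    have hc0 : c ≠ 0 := by
      rintro rfl
      obtain ⟨x, hx⟩ := hne
      have h3 := hc (inv_mem_J h hx)
      rw [mem_mul_sp] at h3
      obtain ⟨p, _, h4⟩ := h3
      rw [mul_zero, zero_eq_inv] at h4
      exact hx (h4 ▸ W.zero_mem)
    have := h2 h1
    rw [mem_sp_iff hc0, mul_inv_cancel₀ hc0] at this
    exact one_notMem_J h this
  · have hc0 : c ≠ 0 := by rintro rfl; exact h1 (Submodule.zero_mem _)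
    have := inv_mem_W h h1
    intro x hx
    rw [mem_sp_iff hc0]
    exact h.mul _ hx _ this

theorem lstar_Jsp (hJ : Jm W h * Jm W h = Jm W h) (hne : ∃ x, x ∉ W) {c : K} (hc : c ≠ 0) :
    lstar ((Jm W h * sp c : Sm K) : Set K) = ((W * sp c : Sm K) : Set K) := by
  apply Set.Subset.antisymm
  · have := @lstar_subset _ _ ((Jm W h * sp c : Sm K) : Set K) c
    rw [Ol_Jsp h hc, ← coe_mul_sp] at this
    exact this (mul_le_mul_left (Jm_le h) _)
  · intro x hx
    simp only [lstar, Set.mem_iInter]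
    intro d hd
    simp only [Set.mem_ofPred_eq] at hd
    rw [Ol_Jsp h hc, ← coe_mul_sp] at hd ⊢
    have hd' : Jm W h * sp c ≤ W * sp d := hd
    have h1 : Jm W h ≤ W * sp (d * c⁻¹) := by
      rw [← sp_cancel (Jm W h) hc, ← sp_mul_sp, ← mul_assoc]
      exact mul_le_mul_left hd' _
    have h2 := J_nonprincipal h hJ hne h1
    have h3 : W * sp c ≤ W * sp d := by
      have := mul_le_mul_left h2 (sp c)
      rwa [mul_assoc W, sp_mul_sp, mul_assoc, inv_mul_cancel₀ hc, mul_one] at this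
    exact h3 hx

theorem eq_Jsp (hJ : Jm W h * Jm W h = Jm W h) {X : Sm K} {c : K} (hc : c ≠ 0)
    (hs : lstar ((Jm W h * X : Sm K) : Set K) = (W : Set K) * {c}) : Jm W h * X = Jm W h * sp c := by
  have hWI : W * (Jm W h * X) ≤ Jm W h * X := by rw [← mul_assoc, W_mul_J]
  rw [← coe_mul_sp] at hs
  have hOl : Ol ((Jm W h * X : Sm K) : Set K) = W := by
    apply Ol_eq_of hWI
    intro a ha
    have h1 : c ∈ lstar ((Jm W h * X : Sm K) : Set K) := by
      rw [hs]; exact mem_mul_sp.2 ⟨1, h.one, one_mul _⟩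
    have h2 : a * c ∈ lstar ((Jm W h * X : Sm K) : Set K) := by
      simp only [lstar, Set.mem_iInter] at h1 ⊢
      intro d hd
      obtain ⟨w, hw, e, he, h3⟩ := h1 d hd
      refine ⟨a * w, ?_, e, he, ?_⟩
      · intro x hx
        rw [mul_assoc]
        exact ha _ (hw x hx)
      · simp only at h3 ⊢
        rw [mul_assoc, h3]
    rw [hs] at h2
    have h2 : a * c ∈ W * sp c := h2
    rw [mem_sp_iff hc, mul_assoc, mul_inv_cancel₀ hc, mul_one] at h2
    exact h2
  apply le_antisymm
  · have h1 : Jm W h * X ≤ W * sp c := by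
      have := subset_lstar ((Jm W h * X : Sm K) : Set K)
      rw [hs] at this
      exact this
    calc Jm W h * X = Jm W h * (Jm W h * X) := by rw [← mul_assoc, hJ]
      _ ≤ Jm W h * (W * sp c) := mul_le_mul_right h1 _
      _ = Jm W h * sp c := by rw [← mul_assoc, J_mul_W]
  · intro x hx
    obtain ⟨j, hj, rfl⟩ := mem_mul_sp.1 hx
    by_contra h1
    have h2 := le_of_notMem' h hWI h1
    have h3 := @lstar_subset _ _ ((Jm W h * X : Sm K) : Set K) (j * c)
    rw [hOl, ← coe_mul_sp] at h3
    have h4 := h3 h2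
    rw [hs] at h4
    have h5 : c ∈ W * sp (j * c) := h4 (mem_mul_sp.2 ⟨1, h.one, one_mul _⟩)
    obtain ⟨w, hw, h6⟩ := mem_mul_sp.1 h5
    have h7 : w * j = 1 := by
      rw [← mul_assoc] at h6
      exact mul_right_cancel₀ hc (by rw [h6, one_mul])
    have := jac_mul_left h hw hj
    rw [h7] at this
    exact one_notMem_J h this

/-- nonprincipal left ideals satisfy `JI = I`. -/
theorem J_mul_of_nonprincipal {I : Sm K} (hI : W * I ≤ I) (hn : ¬ ∃ d, I = W * sp d) :
    Jm W h * I = I := by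
  apply le_antisymm
  · exact (mul_le_mul_left (Jm_le h) _).trans hI
  · intro x hx
    by_contra h1
    apply hn
    refine ⟨x, le_antisymm ?_ ?_⟩
    · intro y hy
      by_contra h2
      have h3 := le_of_notMem h (I := W * sp x) (by rw [← mul_assoc, W_mul_W h]) h2
      have h4 := h3 (mem_mul_sp.2 ⟨1, h.one, one_mul _⟩)
      obtain ⟨j, hj, h5⟩ := mem_mul_sp.1 h4
      apply h1
      rw [← h5]
      exact Submodule.mul_mem_mul hj hy
    · intro y hy
      obtain ⟨w, hw, rfl⟩ := mem_mul_sp.1 hy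
      exact hI (Submodule.mul_mem_mul hw hx)

end tv

section conj
variable {W : Sm K} (h : TV W)

theorem T_symm_inv (f : K ≃+* K) (x : K) : f.symm x⁻¹ = (f.symm x)⁻¹ := map_inv₀ f.symm x

theorem comm_W_iff {f : K ≃+* K} {c : K} (hc : c ≠ 0) (h1 : W * sp c = sp c * T f W) (y : K) :
    c * y * c⁻¹ ∈ W ↔ y ∈ T f W := by
  rw [← mem_sp_iff hc, h1, sp_mem_iff hc, ← mul_assoc, inv_mul_cancel₀ hc, one_mul]

theorem comm_J {f : K ≃+* K} {c : K} (hc : c ≠ 0) (h1 : W * sp c = sp c * T f W) :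
    Jm W h * sp c = sp c * T f (Jm W h) := by
  have key : ∀ y, c * y * c⁻¹ ∈ Jm W h ↔ y ∈ T f (Jm W h) := by
    intro y
    rw [mem_T]
    have e1 := comm_W_iff hc h1 y
    have e2 := comm_W_iff hc h1 y⁻¹
    rw [mem_T] at e1 e2
    have e3 : c * y⁻¹ * c⁻¹ = (c * y * c⁻¹)⁻¹ := by
      rw [mul_inv_rev, mul_inv_rev, inv_inv, mul_assoc]
    rw [e3, T_symm_inv] at e2
    change (_ ∧ _) ↔ (_ ∧ _)
    have e4 : c * y * c⁻¹ = 0 ↔ f.symm y = 0 := by simp [hc]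
    have e1' : c * y * c⁻¹ ∈ (W : Set K) ↔ f.symm y ∈ (W : Set K) := e1
    have e2' : (c * y * c⁻¹)⁻¹ ∈ (W : Set K) ↔ (f.symm y)⁻¹ ∈ (W : Set K) := e2
    rw [e1', e2', e4]
  ext x
  rw [mem_sp_iff hc, sp_mem_iff hc, ← key, ← mul_assoc, mul_inv_cancel₀ hc, one_mul]

theorem comm_inv {P Q : Sm K} {c : K} (hc : c ≠ 0) (h1 : P * sp c = sp c * Q) :
    sp c⁻¹ * P = Q * sp c⁻¹ := by
  calc sp c⁻¹ * P = sp c⁻¹ * (P * sp c * sp c⁻¹) := by rw [sp_cancel P hc]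
    _ = sp c⁻¹ * (sp c * Q) * sp c⁻¹ := by rw [h1]; simp only [mul_assoc]
    _ = _ := by rw [cancel_sp _ hc]

theorem notH {V : Sm K} (hV : TV V) (hVW : V ≤ W) (hJ : Jm W h * Jm W h = Jm W h) {I : Sm K}
    (hVI : V * I ≤ I) (hO : ∀ a, (∀ x ∈ I, a * x ∈ I) → a ∈ W)
    (hne : Jm W h * I ≠ ⊥) (hn : ¬ ∃ c, c ≠ 0 ∧ Jm W h * I = Jm W h * sp c) :
    W * I = I ∧ (¬ ∃ d, I = W * sp d) ∧ lstar (I : Set K) = I := by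
  have hWI : W * I ≤ I := by
    by_contra h1
    obtain ⟨x, hx, hx2⟩ := Set.not_subset.1 h1
    have hx0 : x ≠ 0 := by rintro rfl; exact hx2 I.zero_mem
    have h3 := le_of_notMem' hV hVI hx2
    apply hn
    refine ⟨x, hx0, ?_⟩
    have h4 : W * I = W * sp x := by
      apply le_antisymm
      · calc W * I ≤ W * (V * sp x) := mul_le_mul_right h3 _
          _ ≤ W * (W * sp x) := mul_le_mul_right (mul_le_mul_left hVW _) _
          _ = _ := by rw [← mul_assoc, W_mul_W h]
      · intro y hy
        obtain ⟨w, hw, rfl⟩ := mem_mul_sp.1 hy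
        have := Submodule.mul_mem_mul hw hx
        rwa [← mul_assoc, W_mul_W h] at this
    rw [← J_mul_W h, mul_assoc, h4, ← mul_assoc]
  refine ⟨le_antisymm hWI ?_, ?_, ?_⟩
  · intro x hx; have := Submodule.mul_mem_mul h.one hx; rwa [one_mul] at this
  · rintro ⟨d, hd⟩
    have h5 : Jm W h * I = Jm W h * sp d := by rw [hd, ← mul_assoc, J_mul_W]
    refine hn ⟨d, ?_, h5⟩
    rintro rfl
    apply hne
    rw [h5, sp, Submodule.span_zero_singleton, Submodule.mul_bot]
  · have hOl := Ol_eq_of hWI hO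
    refine Set.Subset.antisymm ?_ (subset_lstar _)
    intro x hx
    by_contra hx2
    have hx2 : x ∉ I := hx2
    have hx0 : x ≠ 0 := by rintro rfl; exact hx2 I.zero_mem
    apply hn
    refine ⟨x, hx0, ?_⟩
    have h6 : I = Jm W h * sp x := by
      apply le_antisymm (le_of_notMem h hWI hx2)
      intro y hy
      obtain ⟨j, hj, rfl⟩ := mem_mul_sp.1 hy
      by_contra h1
      have h2 := le_of_notMem' h hWI h1
      have h3 := @lstar_subset _ _ (I : Set K) (j * x)
      rw [hOl, ← coe_mul_sp] at h3
      have h5 : x ∈ W * sp (j * x) := h3 h2 hx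
      obtain ⟨w, hw, h6⟩ := mem_mul_sp.1 h5
      have h7 : w * j = 1 := by
        rw [← mul_assoc] at h6
        exact mul_right_cancel₀ hx0 (by rw [h6, one_mul])
      have := jac_mul_left h hw hj
      rw [h7] at this
      exact one_notMem_J h this
    conv_lhs => rw [h6, ← mul_assoc, hJ]

end conj

section graded
variable {σ : ℚ → (K ≃+* K)}

theorem T_add (hσ : ∀ r s : ℚ, σ (r + s) = (σ r).trans (σ s)) (r s : ℚ) (P : Sm K) :
    T (σ r) (T (σ s) P) = T (σ (r + s)) P := by
  ext x
  rw [add_comm r s]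
  simp only [mem_T, hσ]
  rfl

theorem sig_zero (hσ : ∀ r s : ℚ, σ (r + s) = (σ r).trans (σ s)) (x : K) : σ 0 x = x := by
  have h1 : σ 0 x = σ 0 (σ 0 x) := by
    have := hσ 0 0
    rw [add_zero] at this
    conv_lhs => rw [this]
    rfl
  exact ((σ 0).injective h1).symm

theorem T_zero (hσ : ∀ r s : ℚ, σ (r + s) = (σ r).trans (σ s)) (P : Sm K) : T (σ 0) P = P := by
  ext x
  conv_lhs => rw [← sig_zero hσ x]
  rw [mem_T']

theorem sig_neg (hσ : ∀ r s : ℚ, σ (r + s) = (σ r).trans (σ s)) (r : ℚ) (x : K) :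
    σ r (σ (-r) x) = x := by
  have := hσ (-r) r
  rw [neg_add_cancel] at this
  have e := sig_zero hσ x
  rw [this] at e
  exact e

structure GE (H : Set ℚ) (σ : ℚ → (K ≃+* K)) (V : Sm K) (A : ℚ → Sm K) : Prop where
  zero : A 0 = V
  un : ∀ r ∈ H, ∀ x, x ≠ 0 → x ∈ A r ∨ x⁻¹ ∈ T (σ r) (A (-r))
  mul : ∀ r ∈ H, ∀ s ∈ H, A r * T (σ r) (A s) ≤ A (r + s)

theorem GE_iff (H : Set ℚ) (σ : ℚ → (K ≃+* K)) (V : Sm K) (A : ℚ → Sm K) :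
    IsGradedExtOn H (V : Set K) σ (fun r => (A r : Set K)) ↔ GE H σ V A := by
  have key : ∀ r, ((A r : Set K) ∪ (σ r '' invS (A (-r) : Set K)) = Set.univ) ↔
      ∀ x, x ≠ 0 → x ∈ A r ∨ x⁻¹ ∈ T (σ r) (A (-r)) := by
    intro r
    rw [Set.eq_univ_iff_forall]
    constructor
    · intro h1 x hx
      rcases h1 x with h2 | ⟨y, ⟨z, hz, hz0, rfl⟩, rfl⟩
      · exact Or.inl h2
      · right
        rw [← map_inv₀, inv_inv, mem_T']
        exact hz
    · intro h1 x
      by_cases hx : x = 0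
      · left; rw [hx]; exact (A r).zero_mem
      · rcases h1 x hx with h2 | h2
        · exact Or.inl h2
        · right
          rw [mem_T] at h2
          exact ⟨_, ⟨_, h2, by simpa using hx, rfl⟩, by simp⟩
  constructor
  · rintro ⟨_, h2, h3, h4⟩
    refine ⟨SetLike.coe_injective h2, fun r hr => (key r).1 (h3 r hr), fun r hr s hs => ?_⟩
    have := h4 r hr s hs
    rw [← coe_T, ← coe_mul] at this
    exact this
  · intro h
    refine ⟨fun r _ => isAddSubgrp _, congrArg _ h.zero, fun r hr => (key r).2 (h.un r hr), ?_⟩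
    intro r hr s hs
    rw [← coe_T, ← coe_mul]
    exact h.mul r hr s hs

end graded

section struct
variable {σ : ℚ → (K ≃+* K)} {V W : Sm K} {A : ℚ → Sm K}

theorem A_D_le_V (hA : GE Set.univ σ V A) (r : ℚ) :
    A r * T (σ r) (A (-r)) ≤ V := by
  have := hA.mul r trivial (-r) trivial
  rwa [add_neg_cancel, hA.zero] at this

theorem V_mul_A (hσ : ∀ r s : ℚ, σ (r + s) = (σ r).trans (σ s)) (hA : GE Set.univ σ V A) (r : ℚ) :
    V * A r ≤ A r := by
  have := hA.mul 0 trivial r trivial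
  rwa [zero_add, hA.zero, T_zero hσ] at this

theorem D_mul (hσ : ∀ r s : ℚ, σ (r + s) = (σ r).trans (σ s)) (hA : GE Set.univ σ V A) (r s : ℚ) :
    A r * T (σ r) (A (-r)) * A (r + s) ≤ A r * T (σ r) (A s) := by
  have h1 : T (σ r) (A (-r)) * A (r + s) = T (σ r) (A (-r) * T (σ (-r)) (A (r + s))) := by
    rw [T_mul, T_add hσ, add_neg_cancel, T_zero hσ]
  rw [mul_assoc, h1]
  have h2 := hA.mul (-r) trivial (r + s) trivial
  rw [neg_add_cancel_left] at h2
  exact mul_le_mul_right (T_mono _ h2) _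

theorem J_le_D (hσ : ∀ r s : ℚ, σ (r + s) = (σ r).trans (σ s)) (hA : GE Set.univ σ V A)
    (hV : TV V) (h : TV W) (hWr : ∀ r a, (∀ x ∈ A r, a * x ∈ A r) → a ∈ W) (r : ℚ) :
    Jm W h ≤ A r * T (σ r) (A (-r)) := by
  intro a ha
  by_contra hn
  have ha0 : a ≠ 0 := by rintro rfl; exact hn (Submodule.zero_mem _)
  have hVA := V_mul_A hσ hA r
  have h1 := le_of_notMem' hV (I := A r * T (σ r) (A (-r)))
    (by rw [← mul_assoc]; exact mul_le_mul_left hVA _) hn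
  have h2 : ∀ z ∈ T (σ r) (A (-r)), z * a⁻¹ ∈ T (σ r) (A (-r)) := by
    intro z hz
    by_contra h3
    have hz0 : z ≠ 0 := by rintro rfl; apply h3; rw [zero_mul]; exact Submodule.zero_mem _
    have h4 := (hA.un r trivial (z * a⁻¹)⁻¹ (inv_ne_zero (mul_ne_zero hz0 (inv_ne_zero ha0))))
    rw [inv_inv] at h4
    have h5 := h4.resolve_right h3
    have h6 := Submodule.mul_mem_mul h5 hz
    rw [mul_inv_rev, inv_inv, mul_assoc, inv_mul_cancel₀ hz0, mul_one] at h6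
    exact hn h6
  apply inv_notMem_W h ha ha0
  apply hWr r
  intro x hx
  by_contra h3
  have hx0 : x ≠ 0 := by rintro rfl; apply h3; rw [mul_zero]; exact Submodule.zero_mem _
  have h4 := (hA.un r trivial (a⁻¹ * x) (mul_ne_zero (inv_ne_zero ha0) hx0)).resolve_left h3
  rw [mul_inv_rev, inv_inv] at h4
  have h5 := h2 _ h4
  rw [mul_assoc, mul_inv_cancel₀ ha0, mul_one] at h5
  have h6 := h2 _ h5
  have h7 := A_D_le_V hA r (Submodule.mul_mem_mul hx h6)
  rw [← mul_assoc, mul_inv_cancel₀ hx0, one_mul] at h7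
  exact h3 (hVA (Submodule.mul_mem_mul h7 hx))

/-- structure of the family `B_r = J A_r`. -/
structure BS (σ : ℚ → (K ≃+* K)) (h : TV W) (A : ℚ → Sm K) : Prop where
  zero : Jm W h * A 0 = Jm W h
  add : ∀ r s, (Jm W h * A r) * T (σ r) (Jm W h * A s) = Jm W h * A (r + s)
  right : ∀ r, Jm W h * A r = A r * T (σ r) (Jm W h)
  both : ∀ r, Jm W h * A r * T (σ r) (Jm W h) = Jm W h * A r
  le : ∀ r, Jm W h * A r ≤ A r

theorem J_sub_V (h : TV W) (hV : TV V) (hVW : V ≤ W) : Jm W h ≤ V := by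
  intro x hx
  by_cases hx0 : x = 0
  · rw [hx0]; exact V.zero_mem
  · exact (hV.tot x hx0).resolve_right (fun h1 => inv_notMem_W h hx hx0 (hVW h1))

theorem mk_BS (hσ : ∀ r s : ℚ, σ (r + s) = (σ r).trans (σ s)) (hA : GE Set.univ σ V A)
    (hV : TV V) (h : TV W) (hVW : V ≤ W) (hJ : Jm W h * Jm W h = Jm W h)
    (hWr : ∀ r a, (∀ x ∈ A r, a * x ∈ A r) → a ∈ W)
    (p : ℚ) (hp : A p * T (σ p) (A (-p)) ≤ Jm W h) : BS σ h A := by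
  have hD := J_le_D hσ hA hV h hWr
  have hDp : A p * T (σ p) (A (-p)) = Jm W h := le_antisymm hp (hD p)
  have hadd : ∀ r s, Jm W h * A r * T (σ r) (A s) = Jm W h * A (r + s) := by
    intro r s
    apply le_antisymm
    · rw [mul_assoc]
      exact mul_le_mul_right (hA.mul r trivial s trivial) _
    · calc Jm W h * A (r + s) = Jm W h * (Jm W h * A (r + s)) := by rw [← mul_assoc, hJ]
        _ ≤ Jm W h * (A r * T (σ r) (A (-r)) * A (r + s)) :=
            mul_le_mul_right (mul_le_mul_left (hD r) _) _
        _ ≤ Jm W h * (A r * T (σ r) (A s)) := mul_le_mul_right (D_mul hσ hA r s) _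
        _ = _ := by rw [mul_assoc]
  have hTJ : ∀ r, T (σ r) (Jm W h) * T (σ r) (Jm W h) = T (σ r) (Jm W h) := by
    intro r; rw [← T_mul, hJ]
  have hradd : ∀ r s, A r * T (σ r) (A s) * T (σ (r + s)) (Jm W h)
      = A (r + s) * T (σ (r + s)) (Jm W h) := by
    intro r s
    apply le_antisymm
    · exact mul_le_mul_left (hA.mul r trivial s trivial) _
    · have h1 : A (r + s) * T (σ (r + s)) (Jm W h) ≤ A r * T (σ r) (A s) := by
        have h2 : T (σ (r + s)) (Jm W h) ≤ T (σ (r + s)) (A (-s)) * T (σ r) (A s) := by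
          have := T_mono (σ (r + s)) (hD (-s))
          rwa [T_mul, T_add hσ, neg_neg, add_neg_cancel_right] at this
        have h3 := hA.mul (r + s) trivial (-s) trivial
        rw [add_neg_cancel_right] at h3
        calc _ ≤ A (r + s) * (T (σ (r + s)) (A (-s)) * T (σ r) (A s)) := mul_le_mul_right h2 _
          _ = A (r + s) * T (σ (r + s)) (A (-s)) * T (σ r) (A s) := by rw [mul_assoc]
          _ ≤ _ := mul_le_mul_left h3 _
      calc _ = A (r + s) * T (σ (r + s)) (Jm W h) * T (σ (r + s)) (Jm W h) := by
            rw [mul_assoc, hTJ]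
        _ ≤ _ := mul_le_mul_left h1 _
  have hboth : ∀ r, Jm W h * A r * T (σ r) (Jm W h) = Jm W h * A r := by
    intro r
    rw [← hDp, T_mul, T_add hσ, hDp, ← mul_assoc, hadd, hadd, add_neg_cancel_right]
  have hboth' : ∀ r, Jm W h * A r * T (σ r) (Jm W h) = A r * T (σ r) (Jm W h) := by
    intro r
    have e1 := hradd p (-p + r)
    have e2 := congrArg (T (σ p)) (hradd (-p) r)
    rw [T_mul, T_mul, T_mul, T_add hσ, T_add hσ, add_neg_cancel, T_zero hσ] at e2
    rw [add_neg_cancel_left] at e1 e2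
    rw [← e1, mul_assoc (A p), ← e2, ← hDp]
    simp only [mul_assoc]
  have hright : ∀ r, Jm W h * A r = A r * T (σ r) (Jm W h) := fun r => by
    rw [← hboth, hboth']
  refine ⟨?_, ?_, hright, hboth, ?_⟩
  · rw [hA.zero]
    apply le_antisymm
    · exact (mul_le_mul_right hVW _).trans (J_mul_W h).le
    · intro x hx; have := Submodule.mul_mem_mul hx hV.one; rwa [mul_one] at this
  · intro r s
    rw [T_mul, ← mul_assoc, hboth, hadd]
  · intro r
    exact (mul_le_mul_left (J_sub_V h hV hVW) _).trans (V_mul_A hσ hA r)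

section useBS
variable {h : TV W}

theorem BS.negadd (b : BS σ h A) (r : ℚ) :
    Jm W h * A r * T (σ r) (Jm W h * A (-r)) = Jm W h := by
  rw [b.add, add_neg_cancel, b.zero]

theorem BS.negadd' (hσ : ∀ r s : ℚ, σ (r + s) = (σ r).trans (σ s)) (b : BS σ h A) (r : ℚ) :
    T (σ r) (Jm W h * A (-r)) * (Jm W h * A r) = T (σ r) (Jm W h) := by
  have := congrArg (T (σ r)) (b.negadd (-r))
  rwa [T_mul, T_add hσ, neg_neg, add_neg_cancel, T_zero hσ] at this

theorem BS.Orr (hσ : ∀ r s : ℚ, σ (r + s) = (σ r).trans (σ s)) (b : BS σ h A) (r : ℚ) (a : K) :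
    (∀ x ∈ Jm W h * A r, x * a ∈ Jm W h * A r) ↔ a ∈ T (σ r) W := by
  constructor
  · intro h1
    have h2 : ∀ y ∈ T (σ r) (Jm W h), y * a ∈ T (σ r) (Jm W h) := by
      have h3 : Jm W h * A r * sp a ≤ Jm W h * A r := by
        intro x hx
        obtain ⟨p, hp, rfl⟩ := mem_mul_sp.1 hx
        exact h1 p hp
      have h4 : T (σ r) (Jm W h) * sp a ≤ T (σ r) (Jm W h) := by
        rw [← b.negadd' hσ r, mul_assoc]
        exact mul_le_mul_right h3 _
      intro y hy
      exact h4 (mem_mul_sp.2 ⟨y, hy, rfl⟩)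
    rw [mem_T]
    apply mem_Or_J h
    intro x hx
    have := h2 (σ r x) (mem_T'.2 hx)
    rw [mem_T] at this
    simpa using this
  · intro ha x hx
    have h1 : Jm W h * A r * T (σ r) W = Jm W h * A r := by
      rw [← b.both r, mul_assoc, ← T_mul, J_mul_W]
    have := Submodule.mul_mem_mul hx ha
    rwa [h1] at this

theorem BS.comm (hσ : ∀ r s : ℚ, σ (r + s) = (σ r).trans (σ s)) (b : BS σ h A) {r : ℚ} {c : K}
    (hc : c ≠ 0) (hr : Jm W h * A r = Jm W h * sp c) : W * sp c = sp c * T (σ r) W := by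
  have key : ∀ y, c * y * c⁻¹ ∈ W ↔ y ∈ T (σ r) W := by
    intro y
    rw [← b.Orr hσ r, hr]
    constructor
    · intro hy x hx
      obtain ⟨j, hj, rfl⟩ := mem_mul_sp.1 hx
      rw [mem_sp_iff hc]
      have : _ ∈ Jm W h := jac_mul_right h hj hy
      simpa only [mul_assoc] using this
    · intro hy
      apply mem_Or_J h
      intro x hx
      have := hy (x * c) (mem_mul_sp.2 ⟨x, hx, rfl⟩)
      rw [mem_sp_iff hc] at this
      simpa only [mul_assoc] using this
  ext x
  rw [mem_sp_iff hc, sp_mem_iff hc, ← key, ← mul_assoc, mul_inv_cancel₀ hc, one_mul]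

theorem BS.neg (hσ : ∀ r s : ℚ, σ (r + s) = (σ r).trans (σ s)) (b : BS σ h A)
    (hJ : Jm W h * Jm W h = Jm W h) {r : ℚ} {c : K}
    (hc : c ≠ 0) (hr : Jm W h * A r = Jm W h * sp c) :
    Jm W h * A (-r) = Jm W h * sp (σ (-r) c⁻¹) := by
  have h1 := comm_J h hc (b.comm hσ hc hr)
  have h2 := b.negadd r
  rw [hr, h1, mul_assoc, ← T_mul, ← mul_assoc (Jm W h), hJ] at h2
  have h3 : T (σ r) (Jm W h * A (-r)) = T (σ r) (Jm W h) * sp c⁻¹ := by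
    rw [← comm_inv hc h1, ← h2, cancel_sp _ hc]
    simp only [h2]
  have h4 := congrArg (T (σ (-r))) h3
  rw [T_mul _ (T _ _), T_add hσ, T_add hσ, neg_add_cancel, T_zero hσ, T_zero hσ, T_sp] at h4
  exact h4

theorem BS.addc (b : BS σ h A) {r s : ℚ} {c d : K}
    (hr : Jm W h * A r = Jm W h * sp c) (hs : Jm W h * A s = Jm W h * sp d) :
    Jm W h * A (r + s) = Jm W h * sp (c * σ r d) := by
  rw [← b.add, hs, T_mul, ← mul_assoc, b.both, hr, T_sp, mul_assoc, sp_mul_sp]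

theorem sp_W_unique (hJ : Jm W h * Jm W h = Jm W h) (hne : ∃ x, x ∉ W) {c d : K} (hc : c ≠ 0)
    (hd : d ≠ 0) (hcd : Jm W h * sp c = Jm W h * sp d) : W * sp c = W * sp d := by
  apply SetLike.coe_injective
  rw [← lstar_Jsp h hJ hne hc, ← lstar_Jsp h hJ hne hd, hcd]

end useBS
end struct

theorem cone (N : Set ℚ) (h1 : ∀ r ∈ N, -r ∉ N) (h2 : ∀ r ∈ N, ∀ s, -s ∉ N → r + s ∈ N)
    (g : ℚ) (hg : g ∈ N) : (∀ r, 0 < r → r ∈ N) ∨ (∀ r, r < 0 → r ∈ N) := by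
  have hmul : ∀ r ∈ N, ∀ n : ℕ, ((n + 1 : ℕ) : ℚ) * r ∈ N := by
    intro r hr n
    induction n with
    | zero => simpa using hr
    | succ n ih =>
      have := h2 _ ih r (h1 r hr)
      convert this using 1
      push_cast; ring
  have hG : ∀ r, r ∉ N → -r ∉ N → ∀ n : ℕ, ((n + 1 : ℕ) : ℚ) * r ∉ N := by
    intro r hr hr' n
    induction n with
    | zero => simpa using hr
    | succ n ih =>
      intro h3
      apply ih
      have := h2 _ h3 (-r) (by rwa [neg_neg])
      convert this using 1
      push_cast; ring
  have hpos : ∀ a : ℚ, 0 < a → a * g ∈ N := by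
    intro a ha
    obtain ⟨q, hq⟩ : ∃ q : ℕ, a.den = q + 1 := ⟨a.den - 1, by have := a.pos; omega⟩
    obtain ⟨p, hp⟩ : ∃ p : ℕ, a.num = ((p + 1 : ℕ) : ℤ) := by
      have := Rat.num_pos.2 ha
      exact ⟨(a.num - 1).toNat, by push_cast; omega⟩
    have e : ((q + 1 : ℕ) : ℚ) * (a * g) = ((p + 1 : ℕ) : ℚ) * g := by
      have h3 : (a.den : ℚ) * a = a.num := Rat.den_mul_eq_num a
      rw [hq, hp] at h3
      rw [← mul_assoc, h3]
      norm_cast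
    have h4 := hmul g hg p
    by_contra h3
    by_cases h5 : -(a * g) ∈ N
    · have h6 := hmul _ h5 q
      rw [mul_neg, e] at h6
      exact h1 _ h4 h6
    · have h6 := hG _ h3 h5 q
      rw [e] at h6
      exact h6 h4
  have hg0 : g ≠ 0 := by
    rintro rfl
    have := h1 0 hg
    rw [neg_zero] at this
    exact this hg
  rcases lt_or_gt_of_ne hg0 with h3 | h3
  · right
    intro r hr
    have := hpos (r / g) (div_pos_of_neg_of_neg hr h3)
    rwa [div_mul_cancel₀ _ hg0] at this
  · left
    intro r hr
    have := hpos (r / g) (div_pos hr h3)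
    rwa [div_mul_cancel₀ _ hg0] at this

section fwd
variable {σ : ℚ → (K ≃+* K)} {V W : Sm K} {A : ℚ → Sm K}

def SS (g k : ℚ) : Prop := (0 < g ∧ 0 < k) ∨ (g < 0 ∧ k < 0)

theorem sameSign {N : Set ℚ} {g k : ℚ} (hs : SS g k)
    (hN : (∀ r, 0 < r → r ∈ N) ∨ (∀ r, r < 0 → r ∈ N)) :
    (g ∈ N ∧ k ∈ N ∧ g + k ∈ N) ∨ (-g ∈ N ∧ -k ∈ N ∧ -(g + k) ∈ N) := by
  rcases hs with ⟨h1, h2⟩ | ⟨h1, h2⟩ <;> rcases hN with h3 | h3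
  · left; exact ⟨h3 _ h1, h3 _ h2, h3 _ (by linarith)⟩
  · right; exact ⟨h3 _ (by linarith), h3 _ (by linarith), h3 _ (by linarith)⟩
  · right; exact ⟨h3 _ (by linarith), h3 _ (by linarith), h3 _ (by linarith)⟩
  · left; exact ⟨h3 _ h1, h3 _ h2, h3 _ (by linarith)⟩

theorem exists_ne {P : Sm K} (hP : P ≠ ⊥) : ∃ x ∈ P, x ≠ 0 := Submodule.exists_mem_ne_zero_of_ne_bot hP

theorem Wne (hA : GE Set.univ σ V A) (hVne : ∃ x, x ∉ V) {t : ℚ} (ht : W * A t ≤ A t)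
    {g k : ℚ} (hs : SS g k) (hII : A g * T (σ g) (A k) ≠ A (g + k)) : ∃ x, x ∉ W := by
  by_contra hW
  push Not at hW
  have hTbot : ∀ r, T (σ r) (⊥ : Sm K) = ⊥ := fun r => Submodule.map_bot _
  have h1 : ∀ r, A r = ⊥ → A (-r) ≠ ⊥ := by
    intro r h1 h2
    have := hA.un r trivial 1 one_ne_zero
    rw [h1, h2, hTbot, inv_one, Submodule.mem_bot] at this
    simp at this
  have hN : ∃ r, A r = ⊥ := by
    by_contra hn
    push Not at hn
    obtain ⟨x, hx, hx0⟩ := exists_ne (hn t)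
    obtain ⟨z, hz, hz0⟩ := exists_ne (hn (-t))
    obtain ⟨y, hy⟩ := hVne
    apply hy
    apply A_D_le_V hA t
    have hz1 : σ t z ≠ 0 := by simpa using hz0
    have e1 : y * (σ t z)⁻¹ ∈ A t := by
      have := ht (Submodule.mul_mem_mul (hW (y * (σ t z)⁻¹ * x⁻¹)) hx)
      rwa [mul_assoc _ x⁻¹, inv_mul_cancel₀ hx0, mul_one] at this
    have := Submodule.mul_mem_mul e1 (mem_T'.2 hz : σ t z ∈ T (σ t) (A (-t)))
    rwa [mul_assoc, inv_mul_cancel₀ hz1, mul_one] at this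
  obtain ⟨p, hp⟩ := hN
  have h2 : ∀ r, A r = ⊥ → ∀ s, A (-s) ≠ ⊥ → A (r + s) = ⊥ := by
    intro r hr s hs
    obtain ⟨z, hz, hz0⟩ := exists_ne hs
    rw [eq_bot_iff]
    intro x hx
    have h3 := hA.mul (r + s) trivial (-s) trivial
    rw [add_neg_cancel_right, hr] at h3
    have h4 := h3 (Submodule.mul_mem_mul hx (mem_T'.2 hz))
    rw [Submodule.mem_bot] at h4 ⊢
    rcases mul_eq_zero.1 h4 with h5 | h5
    · exact h5
    · exact absurd (by simpa using h5) hz0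
  have htop : ∀ r, A (-r) = ⊥ → A r = ⊤ := by
    intro r hr
    rw [eq_top_iff]
    intro x _
    by_cases hx : x = 0
    · rw [hx]; exact Submodule.zero_mem _
    · have := hA.un r trivial x hx
      rw [hr, hTbot, Submodule.mem_bot, inv_eq_zero] at this
      exact this.resolve_right hx
  rcases sameSign hs (cone {r | A r = ⊥} h1 h2 p hp) with ⟨e1, e2, e3⟩ | ⟨e1, e2, e3⟩
  · apply hII
    have e1 : A g = ⊥ := e1
    have e3 : A (g + k) = ⊥ := e3
    rw [e1, e3, Submodule.bot_mul]
  · apply hII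
    have e1 := htop _ e1
    have e2 := htop _ e2
    have e3 := htop _ e3
    rw [e1, e2, e3, eq_top_iff]
    intro x _
    have := Submodule.mul_mem_mul (M := (⊤ : Sm K)) (N := T (σ g) ⊤) (m := x) (n := 1) trivial
      (mem_T.2 trivial)
    rwa [mul_one] at this

theorem exP (hσ : ∀ r s : ℚ, σ (r + s) = (σ r).trans (σ s)) (hA : GE Set.univ σ V A) (hV : TV V)
    (h : TV W) (hVW : V ≤ W) {t : ℚ} (ht : W * A t ≤ A t)
    {g k : ℚ} (hII : A g * T (σ g) (A k) ≠ A (g + k)) :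
    ∃ p, A p * T (σ p) (A (-p)) ≤ Jm W h := by
  by_cases hWV : W ≤ V
  · refine ⟨g, ?_⟩
    intro d hd
    by_contra hdJ
    have h1 := hWV (inv_mem_W h hdJ)
    have hd0 : d ≠ 0 := by rintro rfl; exact hdJ (Submodule.zero_mem _)
    have h2 : (1 : K) ∈ A g * T (σ g) (A (-g)) := by
      have h3 : V * (A g * T (σ g) (A (-g))) ≤ A g * T (σ g) (A (-g)) := by
        rw [← mul_assoc]; exact mul_le_mul_left (V_mul_A hσ hA g) _
      have := h3 (Submodule.mul_mem_mul h1 hd)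
      rwa [inv_mul_cancel₀ hd0] at this
    apply hII
    apply le_antisymm (hA.mul g trivial k trivial)
    refine le_trans ?_ (D_mul hσ hA g k)
    intro x hx
    have := Submodule.mul_mem_mul h2 hx
    rwa [one_mul] at this
  · refine ⟨t, ?_⟩
    intro d hd
    by_contra hdJ
    apply hWV
    have h1 := inv_mem_W h hdJ
    have hd0 : d ≠ 0 := by rintro rfl; exact hdJ (Submodule.zero_mem _)
    intro w hw
    apply A_D_le_V hA t
    have h3 : W * (A t * T (σ t) (A (-t))) ≤ A t * T (σ t) (A (-t)) := by
      rw [← mul_assoc]; exact mul_le_mul_left ht _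
    have := h3 (Submodule.mul_mem_mul (h.mul _ hw _ h1) hd)
    rwa [mul_assoc, inv_mul_cancel₀ hd0, mul_one] at this

theorem A_le_W (h : TV W) {I : Sm K} {c : K} (hc : c ≠ 0) (hI : Jm W h * I = Jm W h * sp c) :
    I ≤ W * sp c := by
  intro a ha
  by_contra h1
  have h2 := le_of_notMem h (I := W * sp c) (by rw [← mul_assoc, W_mul_W h]) h1
  obtain ⟨j, hj, h3⟩ := mem_mul_sp.1 (h2 (mem_mul_sp.2 ⟨1, h.one, one_mul _⟩))
  have h4 := Submodule.mul_mem_mul hj ha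
  rw [h3, hI, mem_sp_iff hc, mul_inv_cancel₀ hc] at h4
  exact one_notMem_J h h4

theorem exU (h : TV W) {I : Sm K} {c : K} (hc : c ≠ 0) (hI : Jm W h * I = Jm W h * sp c)
    (hn : ¬ I ≤ Jm W h * I) : ∃ u ∈ I, u ≠ 0 ∧ Jm W h * I = Jm W h * sp u := by
  obtain ⟨u, hu, hu2⟩ := Set.not_subset.1 hn
  have hu2 : u ∉ Jm W h * I := hu2
  have hu0 : u ≠ 0 := by rintro rfl; exact hu2 (Submodule.zero_mem _)
  refine ⟨u, hu, hu0, ?_⟩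
  have h1 := A_le_W h hc hI hu
  rw [mem_sp_iff hc] at h1
  rw [hI, mem_sp_iff hc] at hu2
  have h2 := inv_mem_W h hu2
  rw [mul_inv_rev, inv_inv] at h2
  rw [hI]
  ext x
  rw [mem_sp_iff hc, mem_sp_iff hu0]
  constructor
  · intro hx
    have : _ ∈ Jm W h := jac_mul_right h hx h2
    rwa [mul_assoc, inv_mul_cancel_left₀ hc] at this
  · intro hx
    have : _ ∈ Jm W h := jac_mul_right h hx h1
    rwa [mul_assoc, inv_mul_cancel_left₀ hu0] at this

theorem notBoth (hσ : ∀ r s : ℚ, σ (r + s) = (σ r).trans (σ s)) (hA : GE Set.univ σ V A) (h : TV W)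
    {r : ℚ} {c : K} (hc : c ≠ 0) (h1 : A r ≤ Jm W h * sp c)
    (h2 : A (-r) ≤ Jm W h * sp (σ (-r) c⁻¹)) : False := by
  rcases hA.un r trivial c hc with h3 | h3
  · have := h1 h3
    rw [mem_sp_iff hc, mul_inv_cancel₀ hc] at this
    exact one_notMem_J h this
  · have := T_mono (σ r) h2 h3
    rw [T_mul, T_sp, sig_neg hσ, mem_sp_iff (inv_ne_zero hc), mul_inv_cancel₀ (inv_ne_zero hc),
      mem_T, map_one] at this
    exact one_notMem_J h this

theorem Hproper (hσ : ∀ r s : ℚ, σ (r + s) = (σ r).trans (σ s)) (hA : GE Set.univ σ V A)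
    (h : TV W) (hJ : Jm W h * Jm W h = Jm W h) (hne : ∃ x, x ∉ W) (b : BS σ h A)
    {p : ℚ} (hp : A p * T (σ p) (A (-p)) ≤ Jm W h)
    {g k : ℚ} (hs : SS g k) (hII : A g * T (σ g) (A k) ≠ A (g + k)) 
    (hall : ∀ r, ∃ c, c ≠ 0 ∧ Jm W h * A r = Jm W h * sp c) : False := by
  choose c hc0 hc using hall
  have h1 : ∀ r ∈ {r | A r ≤ Jm W h * A r}, -r ∉ {r | A r ≤ Jm W h * A r} := by
    intro r h1 h2
    have h1 : A r ≤ Jm W h * A r := h1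
    have h2 : A (-r) ≤ Jm W h * A (-r) := h2
    rw [hc r] at h1
    rw [b.neg hσ hJ (hc0 r) (hc r)] at h2
    exact notBoth hσ hA h (hc0 r) h1 h2
  have h2 : ∀ r ∈ {r | A r ≤ Jm W h * A r}, ∀ s, -s ∉ {r | A r ≤ Jm W h * A r} →
      r + s ∈ {r | A r ≤ Jm W h * A r} := by
    intro r hr s hs
    by_contra h3
    have hr : A r ≤ Jm W h * A r := hr
    obtain ⟨u, hu, hu0, hu2⟩ := exU h (hc0 _) (hc _) h3
    obtain ⟨v, hv, hv0, hv2⟩ := exU h (hc0 _) (hc _) hs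
    have e1 := b.addc hu2 hv2
    have e2 := hA.mul (r + s) trivial (-s) trivial
    rw [add_neg_cancel_right] at e1 e2
    have e3 := hr (e2 (Submodule.mul_mem_mul hu (mem_T'.2 hv)))
    have e0 : u * σ (r + s) v ≠ 0 := mul_ne_zero hu0 (by simpa using hv0)
    rw [e1, mem_sp_iff e0, mul_inv_cancel₀ e0] at e3
    exact one_notMem_J h e3
  have hN : ∃ q, q ∈ {r | A r ≤ Jm W h * A r} := by
    by_contra hn
    push Not at hn
    obtain ⟨u, hu, hu0, hu2⟩ := exU h (hc0 _) (hc _) (hn p)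
    obtain ⟨v, hv, hv0, hv2⟩ := exU h (hc0 _) (hc _) (hn (-p))
    have e1 := b.addc hu2 hv2
    rw [add_neg_cancel, b.zero] at e1
    have e3 := hp (Submodule.mul_mem_mul hu (mem_T'.2 hv))
    have e4 := J_nonprincipal h hJ hne (e1.le.trans (mul_le_mul_left (Jm_le h) _)) h.one
    obtain ⟨w, hw, e5⟩ := mem_mul_sp.1 e4
    have : _ ∈ Jm W h := jac_mul_left h hw e3
    rw [e5] at this
    exact one_notMem_J h this
  obtain ⟨q, hq⟩ := hN
  have hfull : ∀ r d, d ≠ 0 → Jm W h * A r = Jm W h * sp d → A (-r) ≤ Jm W h * A (-r) →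
      A r = W * sp d := by
    intro r d hd0 hd hr
    apply le_antisymm (A_le_W h hd0 hd)
    intro x hx
    by_contra hxn
    have hx0 : x ≠ 0 := by rintro rfl; exact hxn (Submodule.zero_mem _)
    have e1 := (hA.un r trivial x hx0).resolve_left hxn
    rw [b.neg hσ hJ hd0 hd] at hr
    have e2 := T_mono (σ r) hr e1
    rw [T_mul, T_sp, sig_neg hσ, ← comm_inv hd0 (comm_J h hd0 (b.comm hσ hd0 hd)),
      sp_mem_iff (inv_ne_zero hd0), inv_inv] at e2
    rw [mem_sp_iff hd0] at hx
    have : _ ∈ Jm W h := jac_mul_left h hx e2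
    rw [mul_assoc, inv_mul_cancel_left₀ hd0, mul_inv_cancel₀ hx0] at this
    exact one_notMem_J h this
  rcases sameSign hs (cone _ h1 h2 q hq) with ⟨e1, e2, e3⟩ | ⟨e1, e2, e3⟩
  · apply hII
    have f : ∀ r, A r ≤ Jm W h * A r → A r = Jm W h * A r := fun r hr => le_antisymm hr (b.le r)
    rw [f _ e1, f _ e2, f _ e3, b.add]
  · apply hII
    rw [hfull _ _ (hc0 g) (hc g) e1, hfull _ _ (hc0 k) (hc k) e2,
      hfull _ _ (mul_ne_zero (hc0 g) (by simpa using hc0 k)) (b.addc (hc g) (hc k)) e3, T_mul, T_sp,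
      ← mul_assoc, mul_assoc W, ← b.comm hσ (hc0 g) (hc g), ← mul_assoc, W_mul_W h, mul_assoc,
      sp_mul_sp]

end fwd
section fwd2
variable {σ : ℚ → (K ≃+* K)} {V W : Sm K} {A : ℚ → Sm K} {h : TV W}

open Classical in
noncomputable def Mf (V W J : Sm K) (A : ℚ → Sm K) (H : Set ℚ) (c : ℚ → K) (r : ℚ) : Sm K :=
  if r = 0 then V else if r ∈ H then (if r < 0 then W * sp (c r) else J * sp (c r)) else A r

theorem WcTWc {r : ℚ} {c d : K} {P Q : Sm K} (hcm : P * sp c = sp c * T (σ r) P) :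
    Q * sp c * T (σ r) (P * sp d) = Q * P * sp (c * σ r d) := by
  rw [T_mul, T_sp, mul_assoc, ← mul_assoc (sp c), ← hcm, mul_assoc P, sp_mul_sp, mul_assoc]

theorem Mf_GE (hσ : ∀ r s : ℚ, σ (r + s) = (σ r).trans (σ s)) (hA : GE Set.univ σ V A)
    (hV : TV V) (hVW : V ≤ W) (hJ : Jm W h * Jm W h = Jm W h) (hne : ∃ x, x ∉ W) (b : BS σ h A)
    {H : Set ℚ} {c : ℚ → K} (h0 : (0 : ℚ) ∈ H) (hneg : ∀ r ∈ H, -r ∈ H)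
    (hadd : ∀ r ∈ H, ∀ s ∈ H, r + s ∈ H)
    (hc0 : ∀ r ∈ H, c r ≠ 0) (hc : ∀ r ∈ H, Jm W h * A r = Jm W h * sp (c r))
    (hn : ∀ r, r ∉ H → Jm W h * A r = A r) :
    GE Set.univ σ V (Mf V W (Jm W h) A H c) := by
  have hM0 : Mf V W (Jm W h) A H c 0 = V := by simp [Mf]
  have hMn : ∀ r ∈ H, r < 0 → Mf V W (Jm W h) A H c r = W * sp (c r) := by
    intro r hr h1; simp [Mf, hr, h1, h1.ne]
  have hMp : ∀ r ∈ H, 0 < r → Mf V W (Jm W h) A H c r = Jm W h * sp (c r) := by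
    intro r hr h1; simp [Mf, hr, h1.ne', h1.not_gt]
  have hMA : ∀ r, r ∉ H → Mf V W (Jm W h) A H c r = A r := by
    intro r hr
    have : r ≠ 0 := by rintro rfl; exact hr h0
    simp [Mf, hr, this]
  generalize Mf V W (Jm W h) A H c = M at *
  have hcm : ∀ r ∈ H, W * sp (c r) = sp (c r) * T (σ r) W := fun r hr =>
    b.comm hσ (hc0 r hr) (hc r hr)
  have hJcm : ∀ r ∈ H, Jm W h * sp (c r) = sp (c r) * T (σ r) (Jm W h) := fun r hr =>
    comm_J h (hc0 r hr) (hcm r hr)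
  have hWc : ∀ r ∈ H, ∀ s ∈ H, W * sp (c r * σ r (c s)) = W * sp (c (r + s)) := by
    intro r hr s hs
    apply sp_W_unique hJ hne (mul_ne_zero (hc0 r hr) (by simpa using hc0 s hs)) (hc0 _ (hadd r hr s hs))
    rw [← b.addc (hc r hr) (hc s hs), hc _ (hadd r hr s hs)]
  have hJW : ∀ x y, W * sp x = W * sp y → Jm W h * sp x = Jm W h * sp y := by
    intro x y e
    rw [← J_mul_W h, mul_assoc, e, ← mul_assoc]
  have hW0 : W * sp (c 0) = W := by
    have := sp_W_unique (h := h) hJ hne (hc0 0 h0) one_ne_zero (by rw [← hc 0 h0, b.zero, sp_one, mul_one])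
    rw [this, sp_one, mul_one]
  have hJ0 : Jm W h * sp (c 0) = Jm W h := by rw [← hc 0 h0, b.zero]
  have hlow : ∀ r ∈ H, Jm W h * sp (c r) ≤ M r := by
    intro r hr
    rcases lt_trichotomy r 0 with h1 | rfl | h1
    · rw [hMn r hr h1]; exact mul_le_mul_left (Jm_le h) _
    · rw [hM0, hJ0]; exact J_sub_V h hV hVW
    · rw [hMp r hr h1]
  have hup : ∀ r ∈ H, M r ≤ W * sp (c r) := by
    intro r hr
    rcases lt_trichotomy r 0 with h1 | rfl | h1
    · rw [hMn r hr h1]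
    · rw [hM0, hW0]; exact hVW
    · rw [hMp r hr h1]; exact mul_le_mul_left (Jm_le h) _
  have hVM : ∀ r ∈ H, V * M r ≤ M r := by
    intro r hr
    rcases lt_trichotomy r 0 with h1 | rfl | h1
    · rw [hMn r hr h1, ← mul_assoc]; exact mul_le_mul_left ((mul_le_mul_left hVW _).trans (W_mul_W h).le) _
    · rw [hM0, Submodule.mul_le]; exact fun x hx y hy => hV.mul x hx y hy
    · rw [hMp r hr h1, ← mul_assoc]; exact mul_le_mul_left ((mul_le_mul_left hVW _).trans (W_mul_J h).le) _
  have hMV : ∀ r ∈ H, M r * T (σ r) V ≤ M r := by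
    intro r hr
    rcases lt_trichotomy r 0 with h1 | rfl | h1
    · rw [hMn r hr h1, hcm r hr, mul_assoc, ← T_mul]
      exact mul_le_mul_right (T_mono _ ((mul_le_mul_right hVW _).trans (W_mul_W h).le)) _
    · rw [hM0, T_zero hσ, Submodule.mul_le]; exact fun x hx y hy => hV.mul x hx y hy
    · rw [hMp r hr h1, hJcm r hr, mul_assoc, ← T_mul]
      exact mul_le_mul_right (T_mono _ ((mul_le_mul_right hVW _).trans (J_mul_W h).le)) _
  refine ⟨hM0, ?_, ?_⟩
  · intro r _ x hx
    by_cases hr : r ∈ H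
    · have hnr := hneg r hr
      have hc1 := hc0 r hr
      have e0 : W * sp (c (-r)) = W * sp (σ (-r) (c r)⁻¹) := by
        apply sp_W_unique (h := h) hJ hne (hc0 _ hnr) (by simpa using hc1)
        rw [← hc _ hnr, b.neg hσ hJ hc1 (hc r hr)]
      have e1 : T (σ r) (W * sp (c (-r))) = sp (c r)⁻¹ * W := by
        rw [e0, T_mul, T_sp, sig_neg hσ, comm_inv hc1 (hcm r hr)]
      have e2 : T (σ r) (Jm W h * sp (c (-r))) = sp (c r)⁻¹ * Jm W h := by
        rw [hJW _ _ e0, T_mul, T_sp, sig_neg hσ, comm_inv hc1 (hJcm r hr)]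
      have e3 : c r * x⁻¹ = (x * (c r)⁻¹)⁻¹ := by rw [mul_inv_rev, inv_inv]
      rcases lt_trichotomy r 0 with h1 | rfl | h1
      · rw [hMn r hr h1, hMp _ hnr (by linarith), e2, mem_sp_iff hc1,
          sp_mem_iff (inv_ne_zero hc1), inv_inv, e3]
        by_cases h2 : x * (c r)⁻¹ ∈ W
        · exact Or.inl h2
        · exact Or.inr (inv_mem_J h h2)
      · rw [hM0, neg_zero, hM0, T_zero hσ]; exact hV.tot x hx
      · rw [hMp r hr h1, hMn _ hnr (by linarith), e1, mem_sp_iff hc1,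
          sp_mem_iff (inv_ne_zero hc1), inv_inv, e3]
        by_cases h2 : x * (c r)⁻¹ ∈ Jm W h
        · exact Or.inl h2
        · exact Or.inr (inv_mem_W h h2)
    · have hr' : -r ∉ H := fun h1 => hr (by simpa using hneg _ h1)
      rw [hMA _ hr, hMA _ hr']; exact hA.un r trivial x hx
  · intro r _ s _
    by_cases hr : r ∈ H <;> by_cases hs : s ∈ H
    · have hrs := hadd r hr s hs
      have e1 : (Jm W h * sp (c r)) * T (σ r) (W * sp (c s)) ≤ M (r + s) := by
        rw [WcTWc (hcm r hr), J_mul_W, hJW _ _ (hWc r hr s hs)]; exact hlow _ hrs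
      have e2 : (W * sp (c r)) * T (σ r) (Jm W h * sp (c s)) ≤ M (r + s) := by
        rw [WcTWc (hJcm r hr), W_mul_J, hJW _ _ (hWc r hr s hs)]; exact hlow _ hrs
      rcases lt_trichotomy r 0 with h1 | rfl | h1
      · rcases lt_trichotomy s 0 with h2 | rfl | h2
        · rw [hMn r hr h1, hMn s hs h2, hMn _ hrs (by linarith), WcTWc (hcm r hr), W_mul_W h,
            hWc r hr s hs]
        · rw [hM0, add_zero]; exact hMV r hr
        · exact (mul_le_mul' (hup r hr) (T_mono _ (hMp s hs h2).le)).trans e2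
      · rw [hM0, zero_add, T_zero hσ]; exact hVM s hs
      · exact (mul_le_mul' (hMp r hr h1).le (T_mono _ (hup s hs))).trans e1
    · have hrs : r + s ∉ H := fun h1 => hs (by simpa using hadd _ (hneg r hr) _ h1)
      rw [hMA _ hrs, hMA _ hs, ← hn s hs]
      refine (mul_le_mul_left (hup r hr) _).trans ?_
      refine le_trans (le_of_eq ?_) (b.le (r + s))
      rw [← b.add, hc r hr, T_mul, mul_assoc W, ← mul_assoc (sp (c r)), ← hJcm r hr, ← mul_assoc W, ← mul_assoc W,
        W_mul_J, mul_assoc, mul_assoc, ← T_mul, hn s hs]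
    · have hrs : r + s ∉ H := fun h1 => hr (by simpa using hadd _ h1 _ (hneg s hs))
      rw [hMA _ hrs, hMA _ hr]
      refine (mul_le_mul_right (T_mono _ (hup s hs)) _).trans ?_
      refine le_trans (le_of_eq ?_) (b.le (r + s))
      have e1 : A r = A r * T (σ r) (Jm W h) := by rw [← b.right, hn r hr]
      rw [← b.add, hc s hs, hn r hr]
      conv_lhs => rw [e1]
      rw [mul_assoc, ← T_mul, ← mul_assoc, J_mul_W]
    · rw [hMA _ hr, hMA _ hs]
      have e1 : A r * T (σ r) (A s) = Jm W h * A (r + s) := by rw [← b.add, hn r hr, hn s hs]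
      rw [e1]
      by_cases hrs : r + s ∈ H
      · rw [hc _ hrs]; exact hlow _ hrs
      · rw [hMA _ hrs]; exact b.le _
end fwd2
section fwd3
variable {σ : ℚ → (K ≃+* K)} {V W : Sm K} {A : ℚ → Sm K}

theorem J_ne_bot (h : TV W) (hne : ∃ x, x ∉ W) : Jm W h ≠ ⊥ := by
  obtain ⟨x, hx⟩ := hne
  intro e
  have h1 := inv_mem_J h hx
  rw [e, Submodule.mem_bot, inv_eq_zero] at h1
  exact hx (h1 ▸ W.zero_mem)

theorem memH (h : TV W) (hJ : Jm W h * Jm W h = Jm W h) (hne : ∃ x, x ∉ W) {X : Sm K}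
    (hX : Jm W h * X ≠ ⊥) :
    (∃ c : K, lstar ((Jm W h * X : Sm K) : Set K) = (W : Set K) * {c}) ↔
      ∃ c, c ≠ 0 ∧ Jm W h * X = Jm W h * sp c := by
  constructor
  · rintro ⟨c, hc⟩
    have hc0 : c ≠ 0 := by
      rintro rfl
      apply hX
      rw [eq_bot_iff]
      intro x hx
      have := subset_lstar _ hx
      rw [hc, ← coe_mul_sp] at this
      obtain ⟨p, _, e⟩ := mem_mul_sp.1 this
      rw [Submodule.mem_bot, ← e, mul_zero]
    exact ⟨c, hc0, eq_Jsp h hJ hc0 hc⟩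
  · rintro ⟨c, hc0, hc⟩
    exact ⟨c, by rw [hc, lstar_Jsp h hJ hne hc0, coe_mul_sp]⟩

theorem fwd_main (hσ : ∀ r s : ℚ, σ (r + s) = (σ r).trans (σ s)) (hA : GE Set.univ σ V A)
    (hV : TV V) (hVne : ∃ x, x ∉ V) (h : TV W) (hVW : V ≤ W) (hJ : Jm W h * Jm W h = Jm W h)
    (hWr : ∀ r a, (∀ x ∈ A r, a * x ∈ A r) → a ∈ W) {t : ℚ} (ht : W * A t ≤ A t)
    {g k : ℚ} (hs : SS g k) (hII : A g * T (σ g) (A k) ≠ A (g + k))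
    {H : Set ℚ} (hH : ∀ r, r ∈ H ↔ ∃ c : K, lstar ((Jm W h * A r : Sm K) : Set K) = (W : Set K) * {c}) :
    ∃ c : ℚ → K, (∀ s ∈ H, lstar ((Jm W h * A s : Sm K) : Set K) = (W * sp (c s) : Sm K)) ∧
      (∀ s ∈ H, W * sp (c s) = sp (c s) * T (σ s) W) ∧
      (∀ s ∈ H, W * sp (c (-s)) = W * sp (σ (-s) (c s)⁻¹)) ∧
      (∀ r ∈ H, ∀ s ∈ H, W * sp (c r) * T (σ r) (W * sp (c s)) = W * sp (c (r + s))) ∧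
      ((0 : ℚ) ∈ H ∧ (∀ a ∈ H, ∀ b ∈ H, a - b ∈ H) ∧ H ≠ {0} ∧ H ≠ Set.univ) ∧
      (∀ s, s ∉ H → lstar (A s : Set K) = A s ∧ W * A s = A s ∧ (¬ ∃ d, A s = W * sp d) ∧
        Orr (A s : Set K) = T (σ s) W) ∧
      ∃ M : ℚ → Sm K, M 0 = V ∧ (∀ s ∈ H, s < 0 → M s = W * sp (c s)) ∧
        (∀ s ∈ H, 0 < s → M s = Jm W h * sp (c s)) ∧ (∀ r, r ∉ H → M r = A r) ∧
        GE Set.univ σ V M := by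
  have hne := Wne hA hVne ht hs hII
  obtain ⟨p, hp⟩ := exP hσ hA hV h hVW ht hII
  have b := mk_BS hσ hA hV h hVW hJ hWr p hp
  have hB : ∀ r, Jm W h * A r ≠ ⊥ := by
    intro r e
    have := b.negadd r
    rw [e, Submodule.bot_mul] at this
    exact J_ne_bot h hne this.symm
  have hH' : ∀ r, r ∈ H ↔ ∃ c, c ≠ 0 ∧ Jm W h * A r = Jm W h * sp c := fun r =>
    (hH r).trans (memH h hJ hne (hB r))
  have h0 : (0 : ℚ) ∈ H := (hH' 0).2 ⟨1, one_ne_zero, by rw [b.zero, sp_one, mul_one]⟩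
  have hneg : ∀ r ∈ H, -r ∈ H := by
    intro r hr
    obtain ⟨c, hc0, hc⟩ := (hH' r).1 hr
    exact (hH' _).2 ⟨_, by simpa using hc0, b.neg hσ hJ hc0 hc⟩
  have hadd : ∀ r ∈ H, ∀ s ∈ H, r + s ∈ H := by
    intro r hr s hs
    obtain ⟨c, hc0, hc⟩ := (hH' r).1 hr
    obtain ⟨d, hd0, hd⟩ := (hH' s).1 hs
    exact (hH' _).2 ⟨_, mul_ne_zero hc0 (by simpa using hd0), b.addc hc hd⟩
  have hnH := fun r (hr : r ∉ H) => notH h hV hVW hJ (V_mul_A hσ hA r) (hWr r) (hB r)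
    (fun e => hr ((hH' r).2 e))
  have hn : ∀ r, r ∉ H → Jm W h * A r = A r := fun r hr =>
    J_mul_of_nonprincipal h (hnH r hr).1.le (hnH r hr).2.1
  have hch : ∀ r, ∃ c, r ∈ H → c ≠ 0 ∧ Jm W h * A r = Jm W h * sp c := by
    intro r
    by_cases hr : r ∈ H
    · obtain ⟨c, hc⟩ := (hH' r).1 hr; exact ⟨c, fun _ => hc⟩
    · exact ⟨0, fun e => absurd e hr⟩
  choose c hcc using hch
  have hc0 : ∀ r ∈ H, c r ≠ 0 := fun r hr => (hcc r hr).1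
  have hc : ∀ r ∈ H, Jm W h * A r = Jm W h * sp (c r) := fun r hr => (hcc r hr).2
  have hcm : ∀ r ∈ H, W * sp (c r) = sp (c r) * T (σ r) W := fun r hr =>
    b.comm hσ (hc0 r hr) (hc r hr)
  refine ⟨c, ?_, hcm, ?_, ?_, ⟨h0, ?_, ?_, ?_⟩, ?_, Mf V W (Jm W h) A H c, ?_, ?_, ?_, ?_,
    Mf_GE hσ hA hV hVW hJ hne b h0 hneg hadd hc0 hc hn⟩
  · intro s hs
    rw [hc s hs, lstar_Jsp h hJ hne (hc0 s hs)]
  · intro s hs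
    apply sp_W_unique (h := h) hJ hne (hc0 _ (hneg s hs)) (by simpa using hc0 s hs)
    rw [← hc _ (hneg s hs), b.neg hσ hJ (hc0 s hs) (hc s hs)]
  · intro r hr s hs
    rw [WcTWc (hcm r hr), W_mul_W h]
    apply sp_W_unique (h := h) hJ hne (mul_ne_zero (hc0 r hr) (by simpa using hc0 s hs))
      (hc0 _ (hadd r hr s hs))
    rw [← b.addc (hc r hr) (hc s hs), hc _ (hadd r hr s hs)]
  · intro x hx y hy
    rw [sub_eq_add_neg]; exact hadd x hx _ (hneg y hy)
  · intro e
    have h1 : g + k ∉ H := by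
      rw [e, Set.mem_singleton_iff]
      rcases hs with ⟨h1, h2⟩ | ⟨h1, h2⟩ <;> intro h3 <;> linarith
    apply hII
    apply le_antisymm (hA.mul g trivial k trivial)
    rw [← hn _ h1]
    exact (mul_le_mul_left (J_le_D hσ hA hV h hWr g) _).trans (D_mul hσ hA g k)
  · intro e
    exact Hproper hσ hA h hJ hne b hp hs hII (fun r => (hH' r).1 (e ▸ trivial))
  · intro s hs
    refine ⟨(hnH s hs).2.2, (hnH s hs).1, (hnH s hs).2.1, ?_⟩
    ext a
    have := b.Orr hσ s a
    rw [hn s hs] at this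
    exact this
  · simp [Mf]
  · intro r hr h1; simp [Mf, hr, h1, h1.ne]
  · intro r hr h1; simp [Mf, hr, h1.ne', h1.not_gt]
  · intro r hr
    have : r ≠ 0 := by rintro rfl; exact hr h0
    simp [Mf, hr, this]
end fwd3

section bwd
variable {σ : ℚ → (K ≃+* K)} {V W : Sm K} {A : ℚ → Sm K}

theorem GE_mono {H H' : Set ℚ} (hA : GE H σ V A) (hh : H' ⊆ H) : GE H' σ V A :=
  ⟨hA.zero, fun r hr => hA.un r (hh hr), fun r hr s hs => hA.mul r (hh hr) s (hh hs)⟩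

theorem bwd_GE (hσ : ∀ r s : ℚ, σ (r + s) = (σ r).trans (σ s))
    (hV : TV V) (h : TV W) (hVW : V ≤ W) {H : Set ℚ} {c : ℚ → K}
    (hc0 : ∀ r ∈ H, c r ≠ 0) (hc : ∀ r ∈ H, Jm W h * A r = Jm W h * sp (c r))
    (hcm : ∀ s ∈ H, W * sp (c s) = sp (c s) * T (σ s) W)
    (h0 : (0 : ℚ) ∈ H) (hsub : ∀ a ∈ H, ∀ b ∈ H, a - b ∈ H) (hA : GE H σ V A)
    (hn : ∀ r, r ∉ H → Jm W h * A r = A r) {M : ℚ → Sm K} (hM : GE Set.univ σ V M)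
    (hMn : ∀ s ∈ H, s < 0 → M s = W * sp (c s)) (hMp : ∀ s ∈ H, 0 < s → M s = Jm W h * sp (c s))
    (hMA : ∀ r, r ∉ H → M r = A r) (hW0 : W * sp (c 0) = W) :
    GE Set.univ σ V A := by
  have hneg : ∀ r ∈ H, -r ∈ H := fun r hr => by simpa using hsub 0 h0 r hr
  have hadd : ∀ r ∈ H, ∀ s ∈ H, r + s ∈ H := fun r hr s hs => by
    simpa using hsub r hr _ (hneg s hs)
  have hJ0 : Jm W h * sp (c 0) = Jm W h := by rw [← J_mul_W h, mul_assoc, hW0]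
  have hlow : ∀ r ∈ H, Jm W h * sp (c r) ≤ M r := by
    intro r hr
    rcases lt_trichotomy r 0 with h1 | rfl | h1
    · rw [hMn r hr h1]; exact mul_le_mul_left (Jm_le h) _
    · rw [hM.zero, hJ0]; exact J_sub_V h hV hVW
    · rw [hMp r hr h1]
  have hup : ∀ r ∈ H, M r ≤ W * sp (c r) := by
    intro r hr
    rcases lt_trichotomy r 0 with h1 | rfl | h1
    · rw [hMn r hr h1]
    · rw [hM.zero, hW0]; exact hVW
    · rw [hMp r hr h1]; exact mul_le_mul_left (Jm_le h) _
  have hle : ∀ r ∈ H, Jm W h * A r ≤ A r := by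
    intro r hr
    have := hA.mul 0 h0 r hr
    rw [T_zero hσ, zero_add, hA.zero] at this
    exact (mul_le_mul_left (J_sub_V h hV hVW) _).trans this
  have hJcm : ∀ r ∈ H, Jm W h * sp (c r) = sp (c r) * T (σ r) (Jm W h) := fun r hr =>
    comm_J h (hc0 r hr) (hcm r hr)
  have hHn : ∀ r ∈ H, ∀ s, s ∉ H → A r * T (σ r) (A s) ≤ A (r + s) := by
    intro r hr s hs
    have hrs : r + s ∉ H := fun h1 => hs (by simpa using hadd _ (hneg r hr) _ h1)
    have e1 : W * sp (c r) * T (σ r) (A s) = Jm W h * sp (c r) * T (σ r) (A s) := by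
      conv_lhs => rw [← hn s hs]
      rw [T_mul, mul_assoc W, ← mul_assoc (sp (c r)), ← hJcm r hr, ← mul_assoc W, ← mul_assoc W, W_mul_J]
    calc A r * T (σ r) (A s) ≤ W * sp (c r) * T (σ r) (A s) :=
          mul_le_mul_left (A_le_W h (hc0 r hr) (hc r hr)) _
      _ ≤ M r * T (σ r) (M s) := by
          rw [e1, hMA s hs]; exact mul_le_mul_left (hlow r hr) _
      _ ≤ A (r + s) := by rw [← hMA _ hrs]; exact hM.mul r trivial s trivial
  have hnn : ∀ r, r ∉ H → ∀ s, s ∉ H → A r * T (σ r) (A s) ≤ A (r + s) := by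
    intro r hr s hs
    have e := hM.mul r trivial s trivial
    rw [hMA r hr, hMA s hs] at e
    by_cases hrs : r + s ∈ H
    · have e2 := mul_le_mul_right (e.trans (hup _ hrs)) (Jm W h)
      rw [← mul_assoc, hn r hr, ← mul_assoc, J_mul_W, ← hc _ hrs] at e2
      exact e2.trans (hle _ hrs)
    · rwa [hMA _ hrs] at e
  have hun : ∀ r x, x ≠ 0 → x ∈ A r ∨ x⁻¹ ∈ T (σ r) (A (-r)) := by
    intro r x hx
    by_cases hr : r ∈ H
    · exact hA.un r hr x hx
    · have hr' : -r ∉ H := fun h1 => hr (by simpa using hneg _ h1)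
      rw [← hMA _ hr, ← hMA _ hr']; exact hM.un r trivial x hx
  refine ⟨hA.zero, fun r _ => hun r, fun r _ s _ => ?_⟩
  by_cases hr : r ∈ H <;> by_cases hs : s ∈ H
  · exact hA.mul r hr s hs
  · exact hHn r hr s hs
  · have hrs : r + s ∉ H := fun h1 => hr (by simpa using hadd _ h1 _ (hneg s hs))
    have hrs' : -(r + s) ∉ H := fun h1 => hrs (by simpa using hneg _ h1)
    have hr' : -r ∉ H := fun h1 => hr (by simpa using hneg _ h1)
    rw [Submodule.mul_le]
    intro a ha y hy
    by_contra hx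
    have hx0 : a * y ≠ 0 := fun e => hx (e ▸ Submodule.zero_mem _)
    have h1 := (hun _ _ hx0).resolve_left hx
    have h2 : y * (a * y)⁻¹ ∈ T (σ r) (A s) * T (σ (r + s)) (A (-(r + s))) :=
      Submodule.mul_mem_mul hy h1
    have ha0 : a ≠ 0 := left_ne_zero_of_mul hx0
    have hy0 : y ≠ 0 := right_ne_zero_of_mul hx0
    rw [← T_add hσ, ← T_mul, mul_inv_rev, mul_inv_cancel_left₀ hy0] at h2
    have h3 := hHn s hs _ hrs'
    rw [show s + -(r + s) = -r by ring] at h3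
    have h4 := Submodule.mul_mem_mul ha (T_mono _ h3 h2)
    rw [mul_inv_cancel₀ ha0, ← hn r hr, mul_assoc] at h4
    have h5 := hnn r hr _ hr'
    rw [add_neg_cancel, hA.zero] at h5
    have h6 := mul_le_mul_right (h5.trans hVW) (Jm W h) h4
    rw [J_mul_W] at h6
    exact one_notMem_J h h6
  · exact hnn r hr s hs

theorem bwd_II (hσ : ∀ r s : ℚ, σ (r + s) = (σ r).trans (σ s))
    (h : TV W) {H : Set ℚ} {c : ℚ → K}
    (hc0 : ∀ r ∈ H, c r ≠ 0) (hc : ∀ r ∈ H, Jm W h * A r = Jm W h * sp (c r))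
    (hcn : ∀ s ∈ H, W * sp (c (-s)) = W * sp (σ (-s) (c s)⁻¹))
    (h0 : (0 : ℚ) ∈ H) (hsub : ∀ a ∈ H, ∀ b ∈ H, a - b ∈ H) (hH0 : H ≠ {0}) (hH1 : H ≠ Set.univ)
    (hA : GE Set.univ σ V A)
    (hn : ∀ r, r ∉ H → Jm W h * A r = A r) :
    ∃ r : ℚ, 0 < r ∧ ∃ j : ℤ, 0 < j ∧ ¬ (A r * T (σ r) (A (j * r)) = A (r + j * r) ∧
      A (-r) * T (σ (-r)) (A (-(j * r))) = A (-(r + j * r))) := by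
  have hneg : ∀ r ∈ H, -r ∈ H := fun r hr => by simpa using hsub 0 h0 r hr
  have hadd : ∀ r ∈ H, ∀ s ∈ H, r + s ∈ H := fun r hr s hs => by
    simpa using hsub r hr _ (hneg s hs)
  obtain ⟨r, hr, hr0⟩ : ∃ r, r ∉ H ∧ 0 < r := by
    obtain ⟨r, hr⟩ := (Set.ne_univ_iff_exists_notMem _).1 hH1
    rcases lt_trichotomy r 0 with h1 | rfl | h1
    · exact ⟨-r, fun h2 => hr (by simpa using hneg _ h2), by linarith⟩
    · exact absurd h0 hr
    · exact ⟨r, hr, h1⟩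
  obtain ⟨x, hx, hx0⟩ : ∃ x ∈ H, x ≠ 0 := by
    by_contra! h1
    exact hH0 (Set.eq_singleton_iff_unique_mem.2 ⟨h0, h1⟩)
  have hz : ∀ n : ℕ, (n : ℚ) * x ∈ H := by
    intro n
    induction n with
    | zero => simpa using h0
    | succ n ih => push_cast; rw [add_mul, one_mul]; exact hadd _ ih _ hx
  have hzz : ∀ n : ℤ, (n : ℚ) * x ∈ H := by
    intro n
    rcases Int.eq_nat_or_neg n with ⟨m, rfl | rfl⟩
    · simpa using hz m
    · simpa using hneg _ (hz m)
  have hn1 : ((r / x).den : ℚ) * r ∈ H := by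
    have := hzz (r / x).num
    rw [← Rat.den_mul_eq_num, mul_assoc, div_mul_cancel₀ _ hx0] at this
    exact this
  obtain ⟨m, hm⟩ : ∃ m : ℕ, (r / x).den = m + 2 := by
    rcases hd : (r / x).den with _ | _ | m
    · exact absurd hd (Rat.den_nz _)
    · rw [hd] at hn1; simp at hn1; exact absurd hn1 hr
    · exact ⟨m, rfl⟩
  rw [hm] at hn1
  have e1 : ((m + 2 : ℕ) : ℚ) * r = r + ((m + 1 : ℤ) : ℚ) * r := by push_cast; ring
  rw [e1] at hn1
  refine ⟨r, hr0, m + 1, by positivity, ?_⟩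
  rintro ⟨f1, f2⟩
  set q := r + ((m + 1 : ℤ) : ℚ) * r with hq
  have hr' : -r ∉ H := fun h1 => hr (by simpa using hneg _ h1)
  refine notBoth hσ hA h (hc0 q hn1) (r := q) ?_ ?_
  · rw [← hc q hn1, ← f1, ← mul_assoc, hn r hr]
  · have e2 : Jm W h * sp (σ (-q) (c q)⁻¹) = Jm W h * sp (c (-q)) := by
      rw [← J_mul_W h, mul_assoc, ← hcn q hn1, ← mul_assoc]
    rw [e2, ← hc _ (hneg q hn1), ← f2, ← mul_assoc, hn _ hr']
end bwd
end GX

/-- Theorem 4.22: characterization of graded extensions of Type (h). -/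
theorem stmt19 (V : Subring K) (hV : IsTVR V) (hVK : (V : Set K) ≠ Set.univ)
    (σ : ℚ → (K ≃+* K)) (hσ : ∀ r s : ℚ, σ (r + s) = (σ r).trans (σ s))
    (A : ℚ → Set K) (hAgrp : ∀ r : ℚ, IsAddSubgrp (A r)) (hA0 : A 0 = (V : Set K))
    (W : Set K) (hW : W = ⋃ r : ℚ, Ol (A r))
    (hJ : aprod (jacS W) (jacS W) = jacS W)
    (t : ℚ) (ht : Ol (A t) = W)
    (H : Set ℚ) (hH : H = {r : ℚ | ∃ c : K, lstar (aprod (jacS W) (A r)) = W * {c}}) :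
    (IsGradedExtQ (V : Set K) σ A ∧ (∃ r : ℚ, 0 < r ∧ ¬ HrTypeI σ A r)) ↔
      (∃ c : ℚ → K,
        (∀ s ∈ H, lstar (aprod (jacS W) (A s)) = W * {c s}) ∧
        (∀ s ∈ H, W * {c s} = {c s} * (σ s '' W)) ∧
        (∀ s ∈ H, W * {c (-s)} = W * {σ (-s) (c s)⁻¹}) ∧
        (∀ r ∈ H, ∀ s ∈ H, aprod (W * {c r}) (σ r '' (W * {c s})) = W * {c (r + s)}) ∧
        ((0 : ℚ) ∈ H ∧ (∀ a ∈ H, ∀ b ∈ H, a - b ∈ H) ∧ H ≠ {0} ∧ H ≠ Set.univ ∧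
          IsGradedExtOn H (V : Set K) σ A) ∧
        (∀ s : ℚ, s ∉ H →
          lstar (A s) = A s ∧ A s = aprod W (A s) ∧
          (¬ ∃ d : K, A s = W * {d}) ∧ Orr (A s) = σ s '' W) ∧
        (∃ M : ℚ → Set K, M 0 = (V : Set K) ∧
          (∀ s ∈ H, s < 0 → M s = W * {c s}) ∧
          (∀ s ∈ H, 0 < s → M s = jacS W * {c s}) ∧
          (∀ r : ℚ, r ∉ H → M r = A r) ∧
          IsGradedExtQ (V : Set K) σ M)) := by
  let P : ℚ → GX.Sm K := fun r => GX.toSm (A r) (hAgrp r)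
  have hP : ∀ r, ((P r : GX.Sm K) : Set K) = A r := fun r => rfl
  have hVg : IsAddSubgrp (V : Set K) := ⟨V.zero_mem, fun x hx y hy => V.sub_mem hx hy⟩
  let Vm : GX.Sm K := GX.toSm (V : Set K) hVg
  have hVm : ((Vm : GX.Sm K) : Set K) = V := rfl
  have hTV : GX.TV Vm := ⟨V.one_mem, fun x hx y hy => V.mul_mem hx hy, fun x hx => hV x hx⟩
  have hWg : IsAddSubgrp W := by
    rw [← ht]
    refine ⟨fun x hx => ?_, fun x hx y hy z hz => ?_⟩
    · rw [zero_mul]; exact (hAgrp t).1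
    · rw [sub_mul]; exact (hAgrp t).2 _ (hx z hz) _ (hy z hz)
  let Wm : GX.Sm K := GX.toSm W hWg
  have hWm : ((Wm : GX.Sm K) : Set K) = W := rfl
  have hVW' : (V : Set K) ⊆ W := by
    intro x hx
    rw [hW, Set.mem_iUnion]
    refine ⟨0, fun y hy => ?_⟩
    rw [hA0] at hy ⊢
    exact V.mul_mem hx hy
  have hVW : Vm ≤ Wm := hVW'
  have h : GX.TV Wm := by
    refine ⟨hVW' V.one_mem, fun x hx y hy => ?_, fun x hx => (hV x hx).imp (fun e => hVW' e) (fun e => hVW' e)⟩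
    have hx' : x ∈ W := hx
    have hy' : y ∈ W := hy
    show x * y ∈ W
    rw [← ht] at hx' hy' ⊢
    intro z hz
    rw [mul_assoc]; exact hx' _ (hy' _ hz)
  have hJm : ((GX.Jm Wm h : GX.Sm K) : Set K) = jacS W := rfl
  have hJ' : GX.Jm Wm h * GX.Jm Wm h = GX.Jm Wm h := by
    apply SetLike.coe_injective
    rw [GX.coe_mul]; exact hJ
  have hWr : ∀ r a, (∀ x ∈ P r, a * x ∈ P r) → a ∈ Wm := by
    intro r a ha
    show a ∈ W
    rw [hW, Set.mem_iUnion]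
    exact ⟨r, ha⟩
  have ht' : Wm * P t ≤ P t := by
    rw [Submodule.mul_le]
    intro x hx y hy
    have hx' : x ∈ W := hx
    rw [← ht] at hx'
    exact hx' y hy
  have hVne : ∃ x, x ∉ Vm := (Set.ne_univ_iff_exists_notMem _).1 hVK
  have hJA : ∀ r, aprod (jacS W) (A r) = ((GX.Jm Wm h * P r : GX.Sm K) : Set K) := fun r => by
    rw [GX.coe_mul]; rfl
  have hH' : ∀ r, r ∈ H ↔ ∃ c : K, lstar ((GX.Jm Wm h * P r : GX.Sm K) : Set K) = (Wm : Set K) * {c} := by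
    intro r
    rw [hH, ← hJA]; rfl
  have hprod : ∀ f : K ≃+* K, ∀ X Y : GX.Sm K, aprod (X : Set K) (f '' (Y : Set K)) =
      ((X * GX.T f Y : GX.Sm K) : Set K) := by
    intro f X Y; rw [GX.coe_mul, GX.coe_T]
  have hpA : ∀ r s q, aprod (A r) (σ r '' A s) = A q ↔ P r * GX.T (σ r) (P s) = P q := by
    intro r s q
    rw [← hP r, ← hP s, ← hP q, hprod]
    exact SetLike.coe_injective.eq_iff
  constructor
  · rintro ⟨hGE, r, hr, hII⟩
    have hA := (GX.GE_iff Set.univ σ Vm P).1 hGE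
    obtain ⟨g, k, hs, hgk⟩ : ∃ g k, GX.SS g k ∧ P g * GX.T (σ g) (P k) ≠ P (g + k) := by
      unfold HrTypeI at hII
      push Not at hII
      obtain ⟨i, j, hi, hj, hij⟩ := hII
      have hi' : (0 : ℚ) < i * r := mul_pos (by exact_mod_cast hi) hr
      have hj' : (0 : ℚ) < j * r := mul_pos (by exact_mod_cast hj) hr
      by_cases e : aprod (A ((i : ℚ) * r)) (σ ((i : ℚ) * r) '' A ((j : ℚ) * r)) = A (((i + j : ℤ) : ℚ) * r)
      · refine ⟨-(i * r), -(j * r), Or.inr ⟨by linarith, by linarith⟩, fun e2 => hij e ?_⟩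
        rw [hpA, e2]
        congr 1; push_cast; ring
      · refine ⟨i * r, j * r, Or.inl ⟨hi', hj'⟩, fun e2 => e ?_⟩
        rw [hpA, e2]
        congr 1; push_cast; ring
    obtain ⟨c, c1, c2, c3, c4, ⟨c5, c6, c7, c8⟩, c9, M, m1, m2, m3, m4, m5⟩ :=
      GX.fwd_main hσ hA hTV hVne h hVW hJ' hWr ht' hs hgk hH'
    refine ⟨c, ?_, ?_, ?_, ?_, ⟨c5, c6, c7, c8, ?_⟩, ?_, fun r => M r, ?_, ?_, ?_, ?_, ?_⟩
    · intro s hs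
      rw [hJA, c1 s hs, GX.coe_mul_sp, hWm]
    · intro s hs
      have := congrArg (fun X : GX.Sm K => (X : Set K)) (c2 s hs)
      simpa only [GX.coe_mul_sp, GX.coe_sp_mul, GX.coe_T, hWm] using this
    · intro s hs
      have := congrArg (fun X : GX.Sm K => (X : Set K)) (c3 s hs)
      simpa only [GX.coe_mul_sp, hWm] using this
    · intro r hr s hs
      have := congrArg (fun X : GX.Sm K => (X : Set K)) (c4 r hr s hs)
      simpa only [← hprod, GX.coe_mul_sp, hWm] using this
    · exact (GX.GE_iff H σ Vm P).2 (GX.GE_mono hA (Set.subset_univ _))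
    · intro s hs
      obtain ⟨d1, d2, d3, d4⟩ := c9 s hs
      refine ⟨d1, ?_, ?_, ?_⟩
      · have := congrArg (fun X : GX.Sm K => (X : Set K)) d2
        simp only [GX.coe_mul] at this
        exact this.symm
      · rintro ⟨d, hd⟩
        exact d3 ⟨d, SetLike.coe_injective (by rw [GX.coe_mul_sp]; exact hd)⟩
      · rw [GX.coe_T] at d4; exact d4
    · show ((M 0 : GX.Sm K) : Set K) = _
      rw [m1, hVm]
    · intro s hs h1
      show ((M s : GX.Sm K) : Set K) = _
      rw [m2 s hs h1, GX.coe_mul_sp, hWm]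
    · intro s hs h1
      show ((M s : GX.Sm K) : Set K) = _
      rw [m3 s hs h1, GX.coe_mul_sp]; rfl
    · intro s hs
      show ((M s : GX.Sm K) : Set K) = _
      rw [m4 s hs, hP]
    · exact (GX.GE_iff Set.univ σ Vm M).2 m5
  · rintro ⟨c, c1, c2, c3, c4, ⟨c5, c6, c7, c8, c8'⟩, c9, M, m1, m2, m3, m4, m5⟩
    have hA := (GX.GE_iff H σ Vm P).1 c8'
    let N : ℚ → GX.Sm K := fun r => GX.toSm (M r) (m5.1 r trivial)
    have hM : GX.GE Set.univ σ Vm N := (GX.GE_iff Set.univ σ Vm N).1 m5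
    have hWc : ∀ d, W * {d} = ((Wm * GX.sp d : GX.Sm K) : Set K) := fun d => by
      rw [GX.coe_mul_sp, hWm]
    have hne : ∃ x, x ∉ Wm := by
      by_contra! hall
      apply c8
      ext r
      simp only [Set.mem_univ, iff_true]
      rw [hH']
      have hb : GX.Jm Wm h = ⊥ := by
        rw [eq_bot_iff]
        intro x hx
        by_contra hx0
        exact GX.inv_notMem_W h hx hx0 (hall _)
      have h1 : Ol (((⊥ : GX.Sm K)) : Set K) = (Wm : Set K) := by
        apply GX.Ol_eq_of
        · rw [Submodule.mul_bot]
        · exact fun a _ => hall a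
      refine ⟨0, ?_⟩
      rw [hb, Submodule.bot_mul]
      apply Set.Subset.antisymm
      · have := GX.lstar_subset (I := ((⊥ : GX.Sm K) : Set K)) (c := 0)
        rw [h1] at this
        apply this
        rintro x hx
        rw [← GX.coe_mul_sp]
        have hx0 : x = 0 := hx
        rw [hx0]; exact Submodule.zero_mem _
      · intro x hx
        apply GX.subset_lstar
        rw [← GX.coe_mul_sp] at hx
        obtain ⟨p, _, e⟩ := GX.mem_mul_sp.1 hx
        rw [← e, mul_zero]; exact Submodule.zero_mem _
    have hJ0 : GX.Jm Wm h * P 0 = GX.Jm Wm h * GX.sp 1 := by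
      rw [GX.sp_one, mul_one, hA.zero]
      apply le_antisymm
      · exact (mul_le_mul_right hVW _).trans (GX.J_mul_W h).le
      · intro x hx
        have := Submodule.mul_mem_mul hx hTV.one
        rwa [mul_one] at this
    have hW0 : Wm * GX.sp (c 0) = Wm := by
      have := c1 0 c5
      rw [hJA, hJ0, GX.lstar_Jsp h hJ' hne one_ne_zero, hWc, GX.sp_one, mul_one] at this
      exact (SetLike.coe_injective this).symm
    have c6' : ∀ r ∈ H, -r ∈ H := fun r hr => by simpa using c6 0 c5 r hr
    have hc0 : ∀ r ∈ H, c r ≠ 0 := by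
      intro r hr e
      have := c4 r hr (-r) (c6' r hr)
      rw [add_neg_cancel, hWc, hWc, hWc, hprod, hW0] at this
      have := SetLike.coe_injective this
      have hz : GX.sp (0 : K) = ⊥ := Submodule.span_zero_singleton ℤ
      rw [e, hz, Submodule.mul_bot, Submodule.bot_mul] at this
      have h1 := h.one
      rw [← this] at h1
      exact one_ne_zero h1
    have hc : ∀ r ∈ H, GX.Jm Wm h * P r = GX.Jm Wm h * GX.sp (c r) := by
      intro r hr
      exact GX.eq_Jsp h hJ' (hc0 r hr) (by rw [← hJA]; exact c1 r hr)
    have hcm : ∀ s ∈ H, Wm * GX.sp (c s) = GX.sp (c s) * GX.T (σ s) Wm := by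
      intro s hs
      apply SetLike.coe_injective
      rw [GX.coe_mul_sp, GX.coe_sp_mul, GX.coe_T]
      exact c2 s hs
    have hcn : ∀ s ∈ H, Wm * GX.sp (c (-s)) = Wm * GX.sp (σ (-s) (c s)⁻¹) := by
      intro s hs
      apply SetLike.coe_injective
      rw [GX.coe_mul_sp, GX.coe_mul_sp]
      exact c3 s hs
    have hn : ∀ r, r ∉ H → GX.Jm Wm h * P r = P r := by
      intro r hr
      obtain ⟨_, d2, d3, _⟩ := c9 r hr
      apply GX.J_mul_of_nonprincipal h
      · apply le_of_eq
        apply SetLike.coe_injective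
        rw [GX.coe_mul]; exact d2.symm
      · rintro ⟨d, hd⟩
        refine d3 ⟨d, ?_⟩
        rw [hWc, ← hd, hP]
    have hAQ : GX.GE Set.univ σ Vm P := by
      refine GX.bwd_GE hσ hTV h hVW hc0 hc hcm c5 c6 hA hn hM ?_ ?_ ?_ hW0
      · intro s hs h1
        apply SetLike.coe_injective
        rw [GX.coe_mul_sp]; exact m2 s hs h1
      · intro s hs h1
        apply SetLike.coe_injective
        rw [GX.coe_mul_sp]; exact m3 s hs h1
      · intro s hs
        apply SetLike.coe_injective
        exact m4 s hs
    refine ⟨(GX.GE_iff Set.univ σ Vm P).2 hAQ, ?_⟩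
    obtain ⟨r, hr, j, hj, hII⟩ := GX.bwd_II hσ h hc0 hc hcn c5 c6 c7 c8 hAQ hn
    refine ⟨r, hr, fun hI => hII ?_⟩
    obtain ⟨f1, f2⟩ := hI 1 j one_pos hj
    have e : (((1 + j : ℤ) : ℚ)) * r = r + j * r := by push_cast; ring
    rw [hpA, e, Int.cast_one, one_mul] at f1 f2
    exact ⟨f1, f2⟩
end
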